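/- arXiv:2409.17658 — 4 statements merged into one kernel-verified Lean document; each statement's English description precedes it below -/
import Mathlib

section
/- For every integer n ≥ 3 with n ≡ 0 (mod 5), the Roman domination number of the cylinder P₈ □ C_n equals ⌈18n/5⌉. -/
open SimpleGraph

/-- A Roman dominating function on `G`: every vertex with value `0` has a neighbor
with value `2`. -/
def IsRomanDominating {V : Type*} (G : SimpleGraph V) (f : V → Fin 3) : Prop :=
  ∀ v, f v = 0 → ∃ w, G.Adj v w ∧ f w = 2

/-- The Roman domination number of a finite graph: the minimum weight
`∑ v, f v` of a Roman dominating function on `G`. -/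
noncomputable def romanDominationNumber {V : Type*} [Fintype V] (G : SimpleGraph V) : ℕ :=
  sInf {k | ∃ f : V → Fin 3, IsRomanDominating G f ∧ ∑ v, (f v : ℕ) = k}

/-! Discharging proof.  Every `2` pays for the (at most five) cells of its closed
neighbourhood; the loss (over-domination, `1`s, and `2`s on the border) in the four top rows
is at least `1/2` per column, and likewise for the four bottom rows. -/

/-- Potential on pairs of consecutive columns of a band of height four
(only the positions of the `2`s matter). -/
def bandPot (a b : Fin 4 → Bool) : ℕ :=
  let c (u : Fin 4 → Bool) : ℕ :=
    (u 0).toNat + 2 * (u 1).toNat + 4 * (u 2).toNat + 8 * (u 3).toNat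
  (1108941494500506382249271063187501825183490012226211865099322884304322109061697775950624313129054311104169165258998986357524503990056754992990992712545727857502157854576500887512114126494050618527658784822743478310070622144084885724
    / 2 ^ (3 * (16 * c a + c b))) % 8

/-- Twice the loss of a cell dominated `t` times. -/
def cellLoss (t : ℕ) : ℕ := if t = 0 then 3 else 2 * t - 2

lemma band_table : ∀ a0 a1 a2 a3 b0 b1 b2 b3 c0 c1 c2 c3 : Bool,
    1 + bandPot ![b0, b1, b2, b3] ![c0, c1, c2, c3] ≤ bandPot ![a0, a1, a2, a3] ![b0, b1, b2, b3]
      + cellLoss (a0.toNat + b0.toNat + c0.toNat + b1.toNat)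
      + cellLoss (a1.toNat + b1.toNat + c1.toNat + b0.toNat + b2.toNat)
      + cellLoss (a2.toNat + b2.toNat + c2.toNat + b1.toNat + b3.toNat)
      + (2 * (a3.toNat + b3.toNat + c3.toNat + b2.toNat) - 2) + 2 * b0.toNat := by
  decide +kernel

lemma cellLoss_le (t y : ℕ) (h : 1 ≤ t + y) : cellLoss t + 2 ≤ 2 * t + 5 * y := by
  unfold cellLoss; split <;> omega

lemma band_ineq (a0 a1 a2 a3 b0 b1 b2 b3 c0 c1 c2 c3 e : Bool) (y0 y1 y2 y3 : ℕ)
    (h0 : 1 ≤ (a0.toNat + b0.toNat + c0.toNat + b1.toNat) + y0)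
    (h1 : 1 ≤ (a1.toNat + b1.toNat + c1.toNat + b0.toNat + b2.toNat) + y1)
    (h2 : 1 ≤ (a2.toNat + b2.toNat + c2.toNat + b1.toNat + b3.toNat) + y2)
    (h3 : 1 ≤ (a3.toNat + b3.toNat + c3.toNat + b2.toNat + e.toNat) + y3) :
    9 + bandPot ![b0, b1, b2, b3] ![c0, c1, c2, c3] ≤ bandPot ![a0, a1, a2, a3] ![b0, b1, b2, b3]
      + 2 * (a0.toNat + a1.toNat + a2.toNat + a3.toNat)
      + 2 * (c0.toNat + c1.toNat + c2.toNat + c3.toNat)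
      + (6 * b0.toNat + 6 * b1.toNat + 6 * b2.toNat + 4 * b3.toNat)
      + 2 * e.toNat + 5 * (y0 + y1 + y2 + y3) := by
  have := band_table a0 a1 a2 a3 b0 b1 b2 b3 c0 c1 c2 c3
  have := cellLoss_le _ _ h0
  have := cellLoss_le _ _ h1
  have := cellLoss_le _ _ h2
  omega

/-- Indicator of the `2`s. -/
def two (f : Fin 3) : Bool := decide (f = 2)

/-- Indicator of the `1`s. -/
def one (f : Fin 3) : ℕ := if f = 1 then 1 else 0

lemma val_eq (f : Fin 3) : (f : ℕ) = 2 * (two f).toNat + one f := by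
  revert f; decide

lemma lower (m : ℕ) (f : Fin 8 × Fin (m + 3) → Fin 3)
    (hf : IsRomanDominating ((pathGraph 8).boxProd (cycleGraph (m + 3))) f) :
    18 * (m + 3) ≤ 5 * ∑ v, (f v : ℕ) := by
  have key : ∀ (i : Fin 8) (j : Fin (m + 3)),
      one (f (i, j)) = 1 ∨ two (f (i, j)) = true ∨ two (f (i, j - 1)) = true ∨
      two (f (i, j + 1)) = true ∨
      ∃ i₂ : Fin 8, (i.val + 1 = i₂.val ∨ i₂.val + 1 = i.val) ∧ two (f (i₂, j)) = true := by
    intro i j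
    have h3 : ∀ z : Fin 3, z = 0 ∨ one z = 1 ∨ two z = true := by decide
    rcases h3 (f (i, j)) with h | h | h
    · obtain ⟨⟨i₂, j₂⟩, hadj, hw⟩ := hf _ h
      rw [boxProd_adj] at hadj
      have hw₂ : two (f (i₂, j₂)) = true := by rw [hw]; rfl
      simp only [pathGraph_adj, cycleGraph_adj] at hadj
      rcases hadj with ⟨ha, rfl⟩ | ⟨ha, rfl⟩
      · exact Or.inr (Or.inr (Or.inr (Or.inr ⟨i₂, ha, hw₂⟩)))
      · rcases ha with ha | ha
        · have : j₂ = j - 1 := by rw [← ha]; abel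
          subst this; tauto
        · have : j₂ = j + 1 := by rw [← ha]; abel
          subst this; tauto
    · tauto
    · tauto
  let P (j : Fin (m + 3)) : ℕ :=
    bandPot ![two (f (0, j)), two (f (1, j)), two (f (2, j)), two (f (3, j))]
      ![two (f (0, j + 1)), two (f (1, j + 1)), two (f (2, j + 1)), two (f (3, j + 1))] +
    bandPot ![two (f (7, j)), two (f (6, j)), two (f (5, j)), two (f (4, j))]
      ![two (f (7, j + 1)), two (f (6, j + 1)), two (f (5, j + 1)), two (f (4, j + 1))]
  let S (j : Fin (m + 3)) : ℕ := ∑ i : Fin 8, (two (f (i, j))).toNat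
  let Y (j : Fin (m + 3)) : ℕ := ∑ i : Fin 8, one (f (i, j))
  have col : ∀ j, 18 + P (j + 1) ≤ P j + 2 * S j + 2 * S (j + 1 + 1) + 6 * S (j + 1)
      + 5 * Y (j + 1) := by
    intro j
    have k : ∀ i : Fin 8, _ := fun i => key i (j + 1)
    have e : j + 1 - 1 = j := by abel
    simp only [e] at k
    have top := band_ineq (two (f (0, j))) (two (f (1, j))) (two (f (2, j))) (two (f (3, j)))
      (two (f (0, j + 1))) (two (f (1, j + 1))) (two (f (2, j + 1))) (two (f (3, j + 1)))
      (two (f (0, j + 1 + 1))) (two (f (1, j + 1 + 1))) (two (f (2, j + 1 + 1)))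
      (two (f (3, j + 1 + 1))) (two (f (4, j + 1)))
      (one (f (0, j + 1))) (one (f (1, j + 1))) (one (f (2, j + 1))) (one (f (3, j + 1)))
      (by have := k 0; simp [Fin.exists_fin_succ] at this
          rcases this with h | h | h | h | h <;> simp [h] <;> omega)
      (by have := k 1; simp [Fin.exists_fin_succ] at this
          rcases this with h | h | h | h | h | h <;> simp [h] <;> omega)
      (by have := k 2; simp [Fin.exists_fin_succ] at this
          rcases this with h | h | h | h | h | h <;> simp [h] <;> omega)
      (by have := k 3; simp [Fin.exists_fin_succ] at this
          rcases this with h | h | h | h | h | h <;> simp [h] <;> omega)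
    have bot := band_ineq (two (f (7, j))) (two (f (6, j))) (two (f (5, j))) (two (f (4, j)))
      (two (f (7, j + 1))) (two (f (6, j + 1))) (two (f (5, j + 1))) (two (f (4, j + 1)))
      (two (f (7, j + 1 + 1))) (two (f (6, j + 1 + 1))) (two (f (5, j + 1 + 1)))
      (two (f (4, j + 1 + 1))) (two (f (3, j + 1)))
      (one (f (7, j + 1))) (one (f (6, j + 1))) (one (f (5, j + 1))) (one (f (4, j + 1)))
      (by have := k 7; simp [Fin.exists_fin_succ] at this
          rcases this with h | h | h | h | h <;> simp [h] <;> omega)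
      (by have := k 6; simp [Fin.exists_fin_succ] at this
          rcases this with h | h | h | h | h | h <;> simp [h] <;> omega)
      (by have := k 5; simp [Fin.exists_fin_succ] at this
          rcases this with h | h | h | h | h | h <;> simp [h] <;> omega)
      (by have := k 4; simp [Fin.exists_fin_succ] at this
          rcases this with h | h | h | h | h | h <;> simp [h] <;> omega)
    simp only [P, S, Y, Fin.sum_univ_eight]
    omega
  have shift : ∀ g : Fin (m + 3) → ℕ, ∑ j, g (j + 1) = ∑ j, g j := fun g =>
    Equiv.sum_comp (Equiv.addRight (1 : Fin (m + 3))) g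
  have tot := Finset.sum_le_sum (fun j (_ : j ∈ Finset.univ) => col j)
  simp only [Finset.sum_add_distrib, ← Finset.mul_sum] at tot
  rw [shift P, shift (fun j => S (j + 1)), shift S, shift Y] at tot
  simp only [Finset.sum_const, Finset.card_univ, Fintype.card_fin, smul_eq_mul] at tot
  have hw : ∑ v, (f v : ℕ) = 2 * ∑ j, S j + ∑ j, Y j := by
    rw [Fintype.sum_prod_type_right, Finset.mul_sum, ← Finset.sum_add_distrib]
    refine Finset.sum_congr rfl fun j _ => ?_
    simp only [S, Y, Finset.mul_sum, ← Finset.sum_add_distrib, ← val_eq]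
  rw [hw]
  omega

/-- The optimal pattern (period five). -/
def pat (i j : ℕ) : Fin 3 :=
  if (j + 3 * i) % 5 = 0 then 2
  else if (i = 0 ∧ j % 5 = 3) ∨ (i = 7 ∧ j % 5 = 1) then 1 else 0

lemma pat_mod (i j : ℕ) : pat i (j % 5) = pat i j := by
  unfold pat
  have : (j % 5 + 3 * i) % 5 = (j + 3 * i) % 5 := by omega
  rw [this, Nat.mod_mod]

lemma pat_congr (i : ℕ) {j j₂ : ℕ} (h : j % 5 = j₂ % 5) : pat i j = pat i j₂ := by
  rw [← pat_mod, h, pat_mod]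

lemma pat_dom : ∀ (i : Fin 8) (j : Fin 5), pat i j = 0 →
    pat i (j + 1) = 2 ∨ pat i (j + 4) = 2 ∨
    ∃ i₂ : Fin 8, (i.val + 1 = i₂.val ∨ i₂.val + 1 = i.val) ∧ pat i₂ j = 2 := by
  decide +kernel

lemma pat_sum (k : ℕ) :
    ∑ j ∈ Finset.range (5 * k), ∑ i : Fin 8, (pat i j : ℕ) = 18 * k := by
  induction k with
  | zero => simp
  | succ k ih =>
    rw [show 5 * (k + 1) = 5 * k + 1 + 1 + 1 + 1 + 1 by ring]
    simp only [Finset.sum_range_succ, ih]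
    have h : ∀ (i r : ℕ), pat i (5 * k + r) = pat i r := fun i r => pat_congr i (by omega)
    have h0 : ∀ (i : ℕ), pat i (5 * k) = pat i 0 := fun i => pat_congr i (by omega)
    simp only [add_assoc, h, h0]
    have : ∑ i : Fin 8, (pat i 0 : ℕ) + (∑ i : Fin 8, (pat i 1 : ℕ) +
      (∑ i : Fin 8, (pat i 2 : ℕ) + (∑ i : Fin 8, (pat i 3 : ℕ) +
        ∑ i : Fin 8, (pat i 4 : ℕ)))) = 18 := by decide +kernel
    omega

lemma upper (m k : ℕ) (hk : m + 3 = 5 * k) :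
    IsRomanDominating ((pathGraph 8).boxProd (cycleGraph (m + 3)))
      (fun v => pat v.1.val v.2.val) ∧
    ∑ v : Fin 8 × Fin (m + 3), (pat v.1.val v.2.val : ℕ) = 18 * k := by
  constructor
  · rintro ⟨i, j⟩ h
    simp only at h
    have hd := pat_dom i ⟨j.val % 5, Nat.mod_lt _ (by norm_num)⟩
    simp only [pat_mod] at hd
    have hv : ∀ j : Fin (m + 3), (j + 1).val % 5 = (j.val % 5 + 1) % 5 := by
      intro j
      have := Fin.val_add_one (n := m + 2) j
      have hj := j.isLt
      split at this
      · next h => rw [this, h, Fin.val_last]; omega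
      · rw [this]; omega
    have hv1 := hv j
    have hv2 : (j - 1).val % 5 = (j.val % 5 + 4) % 5 := by
      have := hv (j - 1)
      rw [show j - 1 + 1 = j by abel] at this
      omega
    rcases hd h with h | h | ⟨i₂, ha, h⟩
    · refine ⟨(i, j + 1), ?_, ?_⟩
      · rw [boxProd_adj]
        right
        simp [cycleGraph_adj]
      · simp only
        rw [pat_congr _ hv1]
        exact h
    · refine ⟨(i, j - 1), ?_, ?_⟩
      · rw [boxProd_adj]
        right
        simp [cycleGraph_adj]
      · simp only
        rw [pat_congr _ hv2]
        exact h
    · refine ⟨(i₂, j), ?_, h⟩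
      rw [boxProd_adj]
      left
      simp [pathGraph_adj, ha]
  · rw [Fintype.sum_prod_type_right, ← pat_sum k, ← hk]
    exact Fin.sum_univ_eq_sum_range (fun j => ∑ i : Fin 8, (pat i j : ℕ)) (m + 3)

/-- for `n ≥ 3` with `n ≡ 0 (mod 5)`, `γ_R(P₈ □ C_n) = ⌈18n/5⌉`. -/
theorem romanDominationNumber_P8_Cn_of_mod_five_eq_zero (n : ℕ) (hn : 3 ≤ n) (h5 : n % 5 = 0) :
    romanDominationNumber ((pathGraph 8).boxProd (cycleGraph n)) =
      ⌈(18 * (n : ℚ)) / 5⌉₊ := by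
  obtain ⟨m, rfl⟩ : ∃ m, n = m + 3 := ⟨n - 3, by omega⟩
  obtain ⟨k, hk⟩ : ∃ k, m + 3 = 5 * k := ⟨(m + 3) / 5, by omega⟩
  have hc : ⌈(18 * ((m + 3 : ℕ) : ℚ)) / 5⌉₊ = 18 * k := by
    rw [hk, show (18 * ((5 * k : ℕ) : ℚ)) / 5 = ((18 * k : ℕ) : ℚ) by push_cast; ring]
    exact Nat.ceil_natCast _
  rw [hc]
  obtain ⟨hu, hs⟩ := upper m k hk
  apply le_antisymm
  · exact Nat.sInf_le ⟨_, hu, hs⟩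
  · refine le_csInf ⟨_, _, hu, hs⟩ ?_
    rintro b ⟨f, hf, rfl⟩
    have := lower m f hf
    omega
end

section
/- For every integer n ≥ 3 with n ≡ 1 (mod 5) and n ≠ 6, the Roman domination number of the cylinder P₈ □ C_n equals ⌈18n/5⌉ + 2. -/
open SimpleGraph

namespace RomanCyl

/-! ### A bit-parallel dynamic program

A set of pairs `(s, a)` (state `s < 3 ^ 8`, level `a < 17`) is stored as a natural number whose
bit number `a * 3 ^ 8 + s` tells whether the pair belongs to the set.  The state of a column has
one base-three digit per cell: `0` for a cell not dominated so far, `1` for a dominated cell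
(or a cell of value one), `2` for a cell of value two. -/

/-- Call `f` on the evaluated argument. -/
def strict {β : Type} (x : ℕ) (f : ℕ → β) : β :=
  Nat.rec (f 0) (fun m _ => f (Nat.succ m)) x

/-- `X` repeated `2 ^ t` times with period `len`. -/
def rep (X len : ℕ) : ℕ → ℕ
  | 0 => X
  | t + 1 => strict (rep X len t) fun Y => Y ||| (Y <<< (len * 2 ^ t))

/-- The positions `p < M * B * 2 ^ t` with `p / B % M = v`. -/
def mask (B M t v : ℕ) : ℕ :=
  rep ((2 ^ B - 1) <<< (v * B)) (M * B) t

/-- transitions `(field, new field, cost)` for the top cell of a column -/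
def tableTop : List (ℕ × ℕ × ℕ) := [
  (0, 2, 2), (1, 0, 0), (1, 1, 3), (1, 2, 4), (2, 1, 0), (2, 1, 5), (2, 2, 6)]

/-- transitions for an inner cell of a column -/
def tableMid : List (ℕ × ℕ × ℕ) := [
  (0, 7, 0), (1, 7, 2), (2, 8, 4), (3, 0, 0), (3, 3, 3), (3, 7, 2), (4, 1, 0), (4, 4, 3),
  (4, 7, 4), (5, 5, 0), (5, 5, 5), (5, 8, 6), (6, 3, 0), (6, 3, 5), (6, 7, 4), (7, 4, 0),
  (7, 4, 5), (7, 7, 6), (8, 5, 2), (8, 5, 7), (8, 8, 8)]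

/-- transitions for the bottom cell of a column -/
def tableBot : List (ℕ × ℕ × ℕ) := [
  (0, 7, 2), (1, 7, 4), (2, 8, 6), (3, 0, 0), (3, 3, 3), (3, 7, 4), (4, 1, 0), (4, 4, 3),
  (4, 7, 6), (5, 5, 0), (5, 5, 5), (5, 8, 8), (6, 3, 0), (6, 3, 5), (6, 7, 6), (7, 4, 0),
  (7, 4, 5), (7, 7, 8), (8, 5, 2), (8, 5, 7), (8, 8, 10)]

/-- Apply a list of transitions to the set `A`, adding the results to `acc`. -/
def applyRules (A B M t : ℕ) : List (ℕ × ℕ × ℕ) → ℕ → ℕ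
  | [], acc => acc
  | (v, v', c) :: rs, acc =>
    applyRules A B M t rs
      (acc ||| (((A &&& mask B M t v) <<< (v' * B + c * 6561)) >>> (v * B)))

/-- Process one cell. -/
def cell (B M t : ℕ) (rs : List (ℕ × ℕ × ℕ)) (A : ℕ) : ℕ :=
  applyRules A B M t rs 0 % 2 ^ 111537

/-- Process one column. -/
def cells (A : ℕ) : ℕ :=
  strict (cell 1 3 16 tableTop A) fun A =>
  strict (cell 1 9 14 tableMid A) fun A =>
  strict (cell 3 9 13 tableMid A) fun A =>
  strict (cell 9 9 11 tableMid A) fun A =>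
  strict (cell 27 9 9 tableMid A) fun A =>
  strict (cell 81 9 8 tableMid A) fun A =>
  strict (cell 243 9 6 tableMid A) fun A =>
  cell 729 9 5 tableBot A

/-- Iteration that computes the potential. -/
def iterV : ℕ → ℕ → ℕ
  | 0, A => A
  | t + 1, A => strict (cells A) fun B => strict (A ||| (B >>> (2 * 6561))) (iterV t)

/-- The pairs `(s, a)` with `a` at least the potential of `s`. -/
def potV : ℕ := iterV 8 (2 ^ 104976 - 2 ^ (6 * 6561))

/-- Remove the elements of `P` from `X`. -/
def remove (X P : ℕ) : ℕ := X ^^^ (X &&& P)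

/-- All pairs with state `s`. -/
def stateMask (s : ℕ) : ℕ := rep (2 ^ s) 6561 4

/-- One pruned column step (`P` is the set of pairs that are thrown away). -/
def step (P d A : ℕ) : ℕ := strict (cells A) fun B => remove (B >>> ((2 + d) * 6561)) P

def iterStep (P : ℕ) : ℕ → ℕ → ℕ
  | 0, A => A
  | t + 1, A => strict (step P 0 A) (iterStep P t)

/-- `V` is a potential. -/
def checkV (V : ℕ) : Bool :=
  strict (V <<< (2 * 6561)) fun V2 =>
    Nat.beq (cells V ||| V2) V2 && Nat.beq ((V >>> (6 * 6561)) % 2 ^ 6561) (2 ^ 6561 - 1)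

/-- No cheap closed walk of length `1` modulo `5` and at least `11` starts at `s`. -/
def checkStart (V s : ℕ) : Bool :=
  strict (V <<< (8 * 6561)) fun P =>
  strict (iterStep P 11 (V &&& stateMask s)) fun U =>
  strict (U ||| iterStep P 5 U) fun U =>
  Nat.beq (U ||| iterStep P 5 U) U && Nat.beq (U &&& stateMask s) 0

/-- The three states that a cheap closed walk cannot avoid. -/
def coreMask : ℕ := stateMask 1328 ||| (stateMask 3931 ||| stateMask 4087)

def runAvoid (P K : ℕ) : ℕ → ℕ → ℕ → Bool
  | 0, _, A => Nat.beq A 0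
  | t + 1, k, A =>
    strict (cells A) fun B =>
      Nat.beq (B % 2 ^ ((2 + (2 * (k + 1) / 3 - 2 * k / 3)) * 6561)) 0 &&
      strict (remove (remove (B >>> ((2 + (2 * (k + 1) / 3 - 2 * k / 3)) * 6561)) P) K)
        (runAvoid P K t (k + 1))

/-- Walks of small average cost cannot avoid the three core states. -/
def checkAvoid (V : ℕ) : Bool :=
  strict (V <<< (8 * 6561)) fun P =>
  strict coreMask fun K => runAvoid P K 41 0 (remove (V <<< (7 * 6561)) K)

theorem checkV_potV : strict potV checkV = true := by decide +kernel

theorem checkStart_1328 : strict potV (fun V => checkStart V 1328) = true := by decide +kernel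

theorem checkStart_3931 : strict potV (fun V => checkStart V 3931) = true := by decide +kernel

theorem checkStart_4087 : strict potV (fun V => checkStart V 4087) = true := by decide +kernel

theorem checkAvoid_potV : strict potV checkAvoid = true := by decide +kernel

/-! ### Soundness of the bit-parallel operations -/

theorem strict_eq {β : Type} (x : ℕ) (f : ℕ → β) : strict x f = f x := by
  cases x <;> rfl

theorem rep_testBit (X len : ℕ) (t p : ℕ) (hp : p < len * 2 ^ t)
    (h : X.testBit (p % len) = true) : (rep X len t).testBit p = true := by
  induction t generalizing p with
  | zero =>
    have : p % len = p := Nat.mod_eq_of_lt (by simpa using hp)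
    simpa [rep, this] using h
  | succ t ih =>
    simp only [rep, strict_eq, Nat.testBit_or, Nat.testBit_shiftLeft, Bool.or_eq_true,
      Bool.and_eq_true, decide_eq_true_eq]
    by_cases hlt : p < len * 2 ^ t
    · exact Or.inl (ih p hlt h)
    · right
      refine ⟨by omega, ih _ ?_ ?_⟩
      · rw [pow_succ] at hp
        have : len * (2 ^ t * 2) = len * 2 ^ t + len * 2 ^ t := by ring
        omega
      · rwa [Nat.sub_mul_mod (by omega)]

theorem mask_testBit (B M t v p : ℕ) (hp : p < M * B * 2 ^ t)
    (hv : p / B % M = v) : (mask B M t v).testBit p = true := by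
  unfold mask
  apply rep_testBit _ _ _ _ hp
  have hB : 0 < B := by
    rcases Nat.eq_zero_or_pos B with h | h
    · subst h; simp at hp
    · exact h
  have h1 : p % (M * B) / B = v := by
    rw [mul_comm, Nat.mod_mul_right_div_self, hv]
  have h2 := Nat.div_add_mod (p % (M * B)) B
  have h3 := Nat.mod_lt (p % (M * B)) hB
  rw [h1, mul_comm] at h2
  simp only [Nat.testBit_shiftLeft, Nat.testBit_two_pow_sub_one, Bool.and_eq_true,
    decide_eq_true_eq]
  omega

theorem applyRules_acc (A B M t : ℕ) (rs : List (ℕ × ℕ × ℕ)) (acc p : ℕ)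
    (h : acc.testBit p = true) : (applyRules A B M t rs acc).testBit p = true := by
  induction rs generalizing acc with
  | nil => simpa [applyRules] using h
  | cons r rs ih =>
    obtain ⟨v, v', c⟩ := r
    simp only [applyRules]
    apply ih
    rw [Nat.testBit_or, h, Bool.true_or]

theorem applyRules_mem (A B M t : ℕ) (rs : List (ℕ × ℕ × ℕ)) (acc p p' v v' c : ℕ)
    (hr : (v, v', c) ∈ rs) (hA : A.testBit p = true) (hp : p < M * B * 2 ^ t)
    (hv : p / B % M = v) (hp' : p' + v * B = p + (v' * B + c * 6561)) :
    (applyRules A B M t rs acc).testBit p' = true := by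
  induction rs generalizing acc with
  | nil => simp at hr
  | cons r rs ih =>
    rcases List.mem_cons.1 hr with h | h
    · subst h
      simp only [applyRules]
      apply applyRules_acc
      simp only [Nat.testBit_or, Nat.testBit_shiftRight, Nat.testBit_shiftLeft, Nat.testBit_and,
        Bool.or_eq_true, Bool.and_eq_true, decide_eq_true_eq]
      right
      have h1 : v * B + p' - (v' * B + c * 6561) = p := by omega
      rw [h1]
      exact ⟨by omega, hA, mask_testBit _ _ _ _ _ hp hv⟩
    · obtain ⟨w, w', d⟩ := r
      exact ih _ h

theorem cell_mem (B M t : ℕ) (rs : List (ℕ × ℕ × ℕ)) (A p p' v v' c : ℕ)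
    (hr : (v, v', c) ∈ rs) (hA : A.testBit p = true) (hp : p < M * B * 2 ^ t)
    (hv : p / B % M = v) (hp' : p' + v * B = p + (v' * B + c * 6561)) (hlt : p' < 111537) :
    (cell B M t rs A).testBit p' = true := by
  unfold cell
  rw [Nat.testBit_mod_two_pow, applyRules_mem A B M t rs 0 p p' v v' c hr hA hp hv hp']
  simpa using hlt

/-! ### The transition rule of a column -/

/-- Provisional digit of a new cell with value `x`, where `u` is the digit above and `o` the digit
to the left. -/
def gd (u o x : ℕ) : ℕ := if x = 2 then 2 else if x = 1 ∨ u = 2 ∨ o = 2 then 1 else 0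

/-- Final digit of the cell with provisional digit `u` above a cell with value `x`. -/
def ud (u x : ℕ) : ℕ := if x = 2 ∧ u = 0 then 1 else u

/-- Cost of a new cell. -/
def cst (u o x : ℕ) : ℕ :=
  if x = 0 then (if u = 2 ∧ o = 2 then 2 else 0)
  else if x = 1 then 3 + (if u = 2 then 2 else 0) + (if o = 2 then 2 else 0)
  else (if u = 2 then 4 else if u = 0 then 0 else 2) + (if o = 2 then 4 else if o = 0 then 0 else 2)

theorem mem_top : ∀ o < 3, ∀ x < 3, (o = 0 → x = 2) → (o, gd 1 o x, cst 1 o x) ∈ tableTop := by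
  intro o ho x hx h
  interval_cases o <;> interval_cases x <;> first | exact absurd (h rfl) (by decide) | decide

theorem mem_mid : ∀ u < 3, ∀ o < 3, ∀ x < 3, (o = 0 → x = 2) →
    (u + 3 * o, ud u x + 3 * gd u o x, cst u o x) ∈ tableMid := by
  intro u hu o ho x hx h
  interval_cases u <;> interval_cases o <;> interval_cases x <;>
    first | exact absurd (h rfl) (by decide) | decide

theorem mem_bot : ∀ u < 3, ∀ o < 3, ∀ x < 3, (o = 0 → x = 2) →
    (u + 3 * o, ud u x + 3 * gd u o x, cst u o x + if x = 2 then 2 else 0) ∈ tableBot := by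
  intro u hu o ho x hx h
  interval_cases u <;> interval_cases o <;> interval_cases x <;>
    first | exact absurd (h rfl) (by decide) | decide

theorem gd_lt (u o x : ℕ) : gd u o x < 3 := by
  unfold gd; split_ifs <;> omega

theorem ud_lt (u x : ℕ) (h : u < 3) : ud u x < 3 := by
  unfold ud; split_ifs <;> omega

/-- Weight of a digit in the cost balance. -/
def psi (d : ℕ) : ℤ := if d = 0 then 2 else if d = 2 then -2 else 0

theorem cst_eq : ∀ u < 3, ∀ o < 3, ∀ x < 3, (o = 0 → x = 2) →
    (cst u o x : ℤ) = 5 * (x : ℤ) - 2 + (psi (ud u x) - psi u) + (psi (gd u o x) - psi o)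
      - (if gd u o x = 2 then 2 else 0) + (if u = 2 then 2 else 0) := by
  decide

/-- A semantic edge of the transfer graph. -/
def Edge (s C t : ℕ) : Prop :=
  ∀ A a : ℕ, A.testBit (a * 6561 + s) = true → a + C < 17 →
    (cells A).testBit ((a + C) * 6561 + t) = true

/-- The provisional digits of a new column. -/
def gdig (d x : ℕ → ℕ) : ℕ → ℕ
  | 0 => gd 1 (d 0) (x 0)
  | i + 1 => gd (gdig d x i) (d (i + 1)) (x (i + 1))

/-- The final digits of a new column. -/
def edig (d x : ℕ → ℕ) (i : ℕ) : ℕ := if i < 7 then ud (gdig d x i) (x (i + 1)) else gdig d x i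

def enc (d : ℕ → ℕ) : ℕ :=
  d 0 + 3 * d 1 + 9 * d 2 + 27 * d 3 + 81 * d 4 + 243 * d 5 + 729 * d 6 + 2187 * d 7

def colCost (d x : ℕ → ℕ) : ℕ :=
  cst 1 (d 0) (x 0) + cst (gdig d x 0) (d 1) (x 1) + cst (gdig d x 1) (d 2) (x 2)
    + cst (gdig d x 2) (d 3) (x 3) + cst (gdig d x 3) (d 4) (x 4) + cst (gdig d x 4) (d 5) (x 5)
    + cst (gdig d x 5) (d 6) (x 6) + (cst (gdig d x 6) (d 7) (x 7) + if x 7 = 2 then 2 else 0)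

theorem gdig_lt (d x : ℕ → ℕ) (i : ℕ) : gdig d x i < 3 := by
  cases i <;> exact gd_lt _ _ _

theorem edig_lt (d x : ℕ → ℕ) (i : ℕ) : edig d x i < 3 := by
  unfold edig
  split_ifs
  · exact ud_lt _ _ (gdig_lt _ _ _)
  · exact gdig_lt _ _ _

theorem edge_col (d x : ℕ → ℕ) (hd : ∀ i < 8, d i < 3) (hx : ∀ i < 8, x i < 3)
    (hdx : ∀ i < 8, d i = 0 → x i = 2) : Edge (enc d) (colCost d x) (enc (edig d x)) := by
  intro A a hA hC
  have m0 := mem_top _ (hd 0 (by omega)) _ (hx 0 (by omega)) (hdx 0 (by omega))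
  have m1 := mem_mid _ (gdig_lt d x 0) _ (hd 1 (by omega)) _ (hx 1 (by omega)) (hdx 1 (by omega))
  have m2 := mem_mid _ (gdig_lt d x 1) _ (hd 2 (by omega)) _ (hx 2 (by omega)) (hdx 2 (by omega))
  have m3 := mem_mid _ (gdig_lt d x 2) _ (hd 3 (by omega)) _ (hx 3 (by omega)) (hdx 3 (by omega))
  have m4 := mem_mid _ (gdig_lt d x 3) _ (hd 4 (by omega)) _ (hx 4 (by omega)) (hdx 4 (by omega))
  have m5 := mem_mid _ (gdig_lt d x 4) _ (hd 5 (by omega)) _ (hx 5 (by omega)) (hdx 5 (by omega))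
  have m6 := mem_mid _ (gdig_lt d x 5) _ (hd 6 (by omega)) _ (hx 6 (by omega)) (hdx 6 (by omega))
  have m7 := mem_bot _ (gdig_lt d x 6) _ (hd 7 (by omega)) _ (hx 7 (by omega)) (hdx 7 (by omega))
  have g0 := gdig_lt d x 0
  have g1 := gdig_lt d x 1
  have g2 := gdig_lt d x 2
  have g3 := gdig_lt d x 3
  have g4 := gdig_lt d x 4
  have g5 := gdig_lt d x 5
  have g6 := gdig_lt d x 6
  have g7 := gdig_lt d x 7
  have u0 := ud_lt _ (x 1) g0
  have u1 := ud_lt _ (x 2) g1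
  have u2 := ud_lt _ (x 3) g2
  have u3 := ud_lt _ (x 4) g3
  have u4 := ud_lt _ (x 5) g4
  have u5 := ud_lt _ (x 6) g5
  have u6 := ud_lt _ (x 7) g6
  have d0 := hd 0 (by omega)
  have d1 := hd 1 (by omega)
  have d2 := hd 2 (by omega)
  have d3 := hd 3 (by omega)
  have d4 := hd 4 (by omega)
  have d5 := hd 5 (by omega)
  have d6 := hd 6 (by omega)
  have d7 := hd 7 (by omega)
  have e7 : edig d x 7 = gdig d x 7 := rfl
  have e0 : edig d x 0 = ud (gdig d x 0) (x 1) := rfl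
  have e1 : edig d x 1 = ud (gdig d x 1) (x 2) := rfl
  have e2 : edig d x 2 = ud (gdig d x 2) (x 3) := rfl
  have e3 : edig d x 3 = ud (gdig d x 3) (x 4) := rfl
  have e4 : edig d x 4 = ud (gdig d x 4) (x 5) := rfl
  have e5 : edig d x 5 = ud (gdig d x 5) (x 6) := rfl
  have e6 : edig d x 6 = ud (gdig d x 6) (x 7) := rfl
  rw [show gd 1 (d 0) (x 0) = gdig d x 0 from rfl] at m0
  rw [show gd (gdig d x 0) (d 1) (x 1) = gdig d x 1 from rfl] at m1
  rw [show gd (gdig d x 1) (d 2) (x 2) = gdig d x 2 from rfl] at m2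
  rw [show gd (gdig d x 2) (d 3) (x 3) = gdig d x 3 from rfl] at m3
  rw [show gd (gdig d x 3) (d 4) (x 4) = gdig d x 4 from rfl] at m4
  rw [show gd (gdig d x 4) (d 5) (x 5) = gdig d x 5 from rfl] at m5
  rw [show gd (gdig d x 5) (d 6) (x 6) = gdig d x 6 from rfl] at m6
  rw [show gd (gdig d x 6) (d 7) (x 7) = gdig d x 7 from rfl] at m7
  unfold enc colCost at *
  simp only [e0, e1, e2, e3, e4, e5, e6, e7]
  clear e0 e1 e2 e3 e4 e5 e6 e7 hd hx hdx
  generalize ud (gdig d x 0) (x 1) = U0 at *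
  generalize ud (gdig d x 1) (x 2) = U1 at *
  generalize ud (gdig d x 2) (x 3) = U2 at *
  generalize ud (gdig d x 3) (x 4) = U3 at *
  generalize ud (gdig d x 4) (x 5) = U4 at *
  generalize ud (gdig d x 5) (x 6) = U5 at *
  generalize ud (gdig d x 6) (x 7) = U6 at *
  generalize cst 1 (d 0) (x 0) = C0 at *
  generalize cst (gdig d x 0) (d 1) (x 1) = C1 at *
  generalize cst (gdig d x 1) (d 2) (x 2) = C2 at *
  generalize cst (gdig d x 2) (d 3) (x 3) = C3 at *
  generalize cst (gdig d x 3) (d 4) (x 4) = C4 at *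
  generalize cst (gdig d x 4) (d 5) (x 5) = C5 at *
  generalize cst (gdig d x 5) (d 6) (x 6) = C6 at *
  generalize (cst (gdig d x 6) (d 7) (x 7) + if x 7 = 2 then 2 else 0) = C7 at *
  generalize gdig d x 0 = G0 at *
  generalize gdig d x 1 = G1 at *
  generalize gdig d x 2 = G2 at *
  generalize gdig d x 3 = G3 at *
  generalize gdig d x 4 = G4 at *
  generalize gdig d x 5 = G5 at *
  generalize gdig d x 6 = G6 at *
  generalize gdig d x 7 = G7 at *
  generalize d 0 = D0 at *
  generalize d 1 = D1 at *
  generalize d 2 = D2 at *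
  generalize d 3 = D3 at *
  generalize d 4 = D4 at *
  generalize d 5 = D5 at *
  generalize d 6 = D6 at *
  generalize d 7 = D7 at *
  clear d x
  simp only [cells, strict_eq]
  have s0 := cell_mem 1 3 16 _ _ _ ((a + C0) * 6561 + (G0 + 3 * D1 + 9 * D2 + 27 * D3 + 81 * D4
    + 243 * D5 + 729 * D6 + 2187 * D7)) _ _ _ m0 hA (by omega) (by omega) (by omega) (by omega)
  have s1 := cell_mem 1 9 14 _ _ _ ((a + C0 + C1) * 6561 + (U0 + 3 * G1 + 9 * D2 + 27 * D3
    + 81 * D4 + 243 * D5 + 729 * D6 + 2187 * D7)) _ _ _ m1 s0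
    (by omega) (by omega) (by omega) (by omega)
  have s2 := cell_mem 3 9 13 _ _ _ ((a + C0 + C1 + C2) * 6561 + (U0 + 3 * U1 + 9 * G2 + 27 * D3
    + 81 * D4 + 243 * D5 + 729 * D6 + 2187 * D7)) _ _ _ m2 s1
    (by omega) (by omega) (by omega) (by omega)
  have s3 := cell_mem 9 9 11 _ _ _ ((a + C0 + C1 + C2 + C3) * 6561 + (U0 + 3 * U1 + 9 * U2
    + 27 * G3 + 81 * D4 + 243 * D5 + 729 * D6 + 2187 * D7)) _ _ _ m3 s2
    (by omega) (by omega) (by omega) (by omega)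
  have s4 := cell_mem 27 9 9 _ _ _ ((a + C0 + C1 + C2 + C3 + C4) * 6561 + (U0 + 3 * U1 + 9 * U2
    + 27 * U3 + 81 * G4 + 243 * D5 + 729 * D6 + 2187 * D7)) _ _ _ m4 s3
    (by omega) (by omega) (by omega) (by omega)
  have s5 := cell_mem 81 9 8 _ _ _ ((a + C0 + C1 + C2 + C3 + C4 + C5) * 6561 + (U0 + 3 * U1
    + 9 * U2 + 27 * U3 + 81 * U4 + 243 * G5 + 729 * D6 + 2187 * D7)) _ _ _ m5 s4
    (by omega) (by omega) (by omega) (by omega)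
  have s6 := cell_mem 243 9 6 _ _ _ ((a + C0 + C1 + C2 + C3 + C4 + C5 + C6) * 6561 + (U0 + 3 * U1
    + 9 * U2 + 27 * U3 + 81 * U4 + 243 * U5 + 729 * G6 + 2187 * D7)) _ _ _ m6 s5
    (by omega) (by omega) (by omega) (by omega)
  exact cell_mem 729 9 5 _ _ _ _ _ _ _ m7 s6
    (by omega) (by omega) (by omega) (by omega)

theorem colCost_eq (d x : ℕ → ℕ) (hd : ∀ i < 8, d i < 3) (hx : ∀ i < 8, x i < 3)
    (hdx : ∀ i < 8, d i = 0 → x i = 2) :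
    (colCost d x : ℤ) = 5 * ∑ i ∈ Finset.range 8, (x i : ℤ) - 16
      + ∑ i ∈ Finset.range 8, psi (edig d x i) - ∑ i ∈ Finset.range 8, psi (d i) := by
  have m0 := cst_eq 1 (by omega) _ (hd 0 (by omega)) _ (hx 0 (by omega)) (hdx 0 (by omega))
  have m1 := cst_eq _ (gdig_lt d x 0) _ (hd 1 (by omega)) _ (hx 1 (by omega)) (hdx 1 (by omega))
  have m2 := cst_eq _ (gdig_lt d x 1) _ (hd 2 (by omega)) _ (hx 2 (by omega)) (hdx 2 (by omega))
  have m3 := cst_eq _ (gdig_lt d x 2) _ (hd 3 (by omega)) _ (hx 3 (by omega)) (hdx 3 (by omega))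
  have m4 := cst_eq _ (gdig_lt d x 3) _ (hd 4 (by omega)) _ (hx 4 (by omega)) (hdx 4 (by omega))
  have m5 := cst_eq _ (gdig_lt d x 4) _ (hd 5 (by omega)) _ (hx 5 (by omega)) (hdx 5 (by omega))
  have m6 := cst_eq _ (gdig_lt d x 5) _ (hd 6 (by omega)) _ (hx 6 (by omega)) (hdx 6 (by omega))
  have m7 := cst_eq _ (gdig_lt d x 6) _ (hd 7 (by omega)) _ (hx 7 (by omega)) (hdx 7 (by omega))
  have e7 : edig d x 7 = gdig d x 7 := rfl
  have e0 : edig d x 0 = ud (gdig d x 0) (x 1) := rfl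
  have e1 : edig d x 1 = ud (gdig d x 1) (x 2) := rfl
  have e2 : edig d x 2 = ud (gdig d x 2) (x 3) := rfl
  have e3 : edig d x 3 = ud (gdig d x 3) (x 4) := rfl
  have e4 : edig d x 4 = ud (gdig d x 4) (x 5) := rfl
  have e5 : edig d x 5 = ud (gdig d x 5) (x 6) := rfl
  have e6 : edig d x 6 = ud (gdig d x 6) (x 7) := rfl
  have hp0 : psi (ud 1 (x 0)) = psi 1 := by
    simp [ud]
  have h7 : gdig d x 7 = 2 ↔ x 7 = 2 := by
    rw [show gdig d x 7 = gd (gdig d x 6) (d 7) (x 7) from rfl]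
    unfold gd
    split_ifs <;> simp_all
  have hb : (if gdig d x 7 = 2 then (2 : ℤ) else 0) = if x 7 = 2 then 2 else 0 := by
    simp only [h7]
  rw [show gd 1 (d 0) (x 0) = gdig d x 0 from rfl] at m0
  rw [show gd (gdig d x 0) (d 1) (x 1) = gdig d x 1 from rfl] at m1
  rw [show gd (gdig d x 1) (d 2) (x 2) = gdig d x 2 from rfl] at m2
  rw [show gd (gdig d x 2) (d 3) (x 3) = gdig d x 3 from rfl] at m3
  rw [show gd (gdig d x 3) (d 4) (x 4) = gdig d x 4 from rfl] at m4
  rw [show gd (gdig d x 4) (d 5) (x 5) = gdig d x 5 from rfl] at m5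
  rw [show gd (gdig d x 5) (d 6) (x 6) = gdig d x 6 from rfl] at m6
  rw [show gd (gdig d x 6) (d 7) (x 7) = gdig d x 7 from rfl, hb] at m7
  rw [if_neg (by omega : ¬ (1 = 2)), hp0] at m0
  simp only [Finset.sum_range_succ, Finset.sum_range_zero, e0, e1, e2, e3, e4, e5, e6, e7, colCost]
  push_cast
  rw [m0, m1, m2, m3, m4, m5, m6, m7]
  ring


/-! ### Closed walks of small cost -/

theorem remove_testBit (X P p : ℕ) (hX : X.testBit p = true) (hP : P.testBit p = false) :
    (remove X P).testBit p = true := by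
  simp [remove, Nat.testBit_xor, Nat.testBit_and, hX, hP]

theorem stateMask_testBit (s a : ℕ) (hs : s < 6561) (ha : a < 16) :
    (stateMask s).testBit (a * 6561 + s) = true := by
  unfold stateMask
  apply rep_testBit
  · omega
  · have : (a * 6561 + s) % 6561 = s := by omega
    rw [this, Nat.testBit_two_pow_self]

theorem rep_testBit_false (X len : ℕ) (t p : ℕ) (hX : X < 2 ^ len)
    (h : X.testBit (p % len) = false) : (rep X len t).testBit p = false := by
  induction t generalizing p with
  | zero =>
    by_cases hp : p < len
    · have : p % len = p := Nat.mod_eq_of_lt hp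
      simpa [rep, this] using h
    · simp only [rep]
      exact Nat.testBit_lt_two_pow (lt_of_lt_of_le hX (Nat.pow_le_pow_right (by omega) (by omega)))
  | succ t ih =>
    simp only [rep, strict_eq, Nat.testBit_or, Nat.testBit_shiftLeft, Bool.or_eq_false_iff,
      Bool.and_eq_false_iff, decide_eq_false_iff_not]
    refine ⟨ih p h, ?_⟩
    by_cases hlt : p ≥ len * 2 ^ t
    · right
      apply ih
      rwa [Nat.sub_mul_mod hlt]
    · exact Or.inl hlt

theorem stateMask_testBit_false (s t a : ℕ) (hs : s < 6561) (ht : t < 6561) (hst : t ≠ s) :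
    (stateMask s).testBit (a * 6561 + t) = false := by
  unfold stateMask
  apply rep_testBit_false
  · exact Nat.pow_lt_pow_right Nat.one_lt_two hs
  · have : (a * 6561 + t) % 6561 = t := by omega
    rw [this, Nat.testBit_two_pow]
    simpa using fun h => hst h.symm

/-- `V` encodes a potential. -/
def IsPot (V : ℕ) : Prop :=
  (∀ s < 6561, V.testBit (6 * 6561 + s) = true) ∧
    ∀ p, (cells V).testBit p = true → (V <<< (2 * 6561)).testBit p = true

theorem isPot_of_check (V : ℕ) (h : checkV V = true) : IsPot V := by
  simp only [checkV, strict_eq, Bool.and_eq_true] at h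
  obtain ⟨h1, h2⟩ := h
  have h1 := Nat.eq_of_beq_eq_true h1
  have h2 := Nat.eq_of_beq_eq_true h2
  refine ⟨fun s hs => ?_, fun p hp => ?_⟩
  · have h3 := congrArg (fun z => z.testBit s) h2
    simp only [Nat.testBit_mod_two_pow, Nat.testBit_shiftRight, Nat.testBit_two_pow_sub_one, hs,
      decide_true, Bool.true_and] at h3
    exact h3
  · rw [← h1, Nat.testBit_or, hp, Bool.true_or]

/-- The potential encoded by `V`. -/
noncomputable def pot (V s : ℕ) : ℕ := sInf {a | V.testBit (a * 6561 + s) = true}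

theorem pot_le (V s a : ℕ) (h : V.testBit (a * 6561 + s) = true) : pot V s ≤ a :=
  Nat.sInf_le h

theorem pot_le_six {V : ℕ} (hV : IsPot V) {s : ℕ} (hs : s < 6561) : pot V s ≤ 6 :=
  pot_le V s 6 (hV.1 s hs)

theorem pot_mem {V : ℕ} (hV : IsPot V) {s : ℕ} (hs : s < 6561) :
    V.testBit (pot V s * 6561 + s) = true :=
  Nat.sInf_mem (s := {a | V.testBit (a * 6561 + s) = true}) ⟨6, hV.1 s hs⟩

theorem pot_edge {V : ℕ} (hV : IsPot V) {s C t : ℕ} (hs : s < 6561) (ht : t < 6561)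
    (h : Edge s C t) : pot V t + 2 ≤ pot V s + C := by
  by_cases hC : pot V s + C < 17
  · have h1 := hV.2 _ (h V _ (pot_mem hV hs) hC)
    simp only [Nat.testBit_shiftLeft, Bool.and_eq_true, decide_eq_true_eq] at h1
    obtain ⟨h2, h3⟩ := h1
    have h4 : (pot V s + C) * 6561 + t - 2 * 6561 = (pot V s + C - 2) * 6561 + t := by omega
    rw [h4] at h3
    have := pot_le _ _ _ h3
    omega
  · have := pot_le_six hV ht
    omega

theorem prune_false (V s b : ℕ) (hs : s < 6561) (hb : b < 8 + pot V s) :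
    (V <<< (8 * 6561)).testBit (b * 6561 + s) = false := by
  by_contra hne
  simp only [Bool.not_eq_false, Nat.testBit_shiftLeft, Bool.and_eq_true, decide_eq_true_eq] at hne
  obtain ⟨h2, h3⟩ := hne
  have h4 : b * 6561 + s - 8 * 6561 = (b - 8) * 6561 + s := by omega
  rw [h4] at h3
  have := pot_le _ _ _ h3
  omega

theorem step_mem {V s t C a b d A : ℕ} (h : Edge s C t) (ht : t < 6561)
    (hA : A.testBit (a * 6561 + s) = true) (hC : a + C < 17) (hb : b + (2 + d) = a + C)
    (hp : b < 8 + pot V t) :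
    (step (V <<< (8 * 6561)) d A).testBit (b * 6561 + t) = true := by
  unfold step
  rw [strict_eq]
  apply remove_testBit
  · rw [Nat.testBit_shiftRight]
    have h1 := h A a hA hC
    have h2 : (2 + d) * 6561 + (b * 6561 + t) = (a + C) * 6561 + t := by
      rw [← hb]; ring
    rwa [h2]
  · exact prune_false V t b ht hp

/-- A walk with its accumulated reduced cost `S`. -/
structure IsWalk (V : ℕ) (s C S : ℕ → ℕ) : Prop where
  lt : ∀ k, s k < 6561
  edge : ∀ k, Edge (s k) (C k) (s (k + 1))
  zero : S 0 = 0
  succ : ∀ k, S (k + 1) + 2 + pot V (s (k + 1)) = S k + pot V (s k) + C k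

theorem iterStep_mem {V : ℕ} (hV : IsPot V) {s C S : ℕ → ℕ} (hw : IsWalk V s C S) (n : ℕ)
    (hS : ∀ k ≤ n, S k ≤ 7) (t : ℕ) : ∀ (k A : ℕ), k + t ≤ n →
    A.testBit ((S k + pot V (s k)) * 6561 + s k) = true →
    (iterStep (V <<< (8 * 6561)) t A).testBit
      ((S (k + t) + pot V (s (k + t))) * 6561 + s (k + t)) = true := by
  induction t with
  | zero => intro k A _ hA; simpa [iterStep] using hA
  | succ t ih =>
    intro k A hk hA
    simp only [iterStep, strict_eq]
    have e : k + (t + 1) = (k + 1) + t := by omega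
    rw [e]
    apply ih (k + 1) _ (by omega)
    have h1 := hw.succ k
    have h2 := hS (k + 1) (by omega)
    have h3 := pot_le_six hV (hw.lt (k + 1))
    exact step_mem (hw.edge k) (hw.lt _) hA (by omega) (by omega) (by omega)

theorem testBit_or_left {X Y p : ℕ} (h : X.testBit p = true) : (X ||| Y).testBit p = true := by
  rw [Nat.testBit_or, h, Bool.true_or]

theorem testBit_or_right {X Y p : ℕ} (h : Y.testBit p = true) : (X ||| Y).testBit p = true := by
  rw [Nat.testBit_or, h, Bool.or_true]

theorem no_walk_core {V : ℕ} (hV : IsPot V) {s0 : ℕ} (hc : checkStart V s0 = true)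
    {s C S : ℕ → ℕ} (hw : IsWalk V s C S) (n : ℕ) (h5 : n % 5 = 1) (hn : 11 ≤ n)
    (hS : ∀ k ≤ n, S k ≤ 7) (h0 : s 0 = s0) (hsn : s n = s0) : False := by
  simp only [checkStart, strict_eq, Bool.and_eq_true] at hc
  generalize hU0 : iterStep (V <<< (8 * 6561)) 11 (V &&& stateMask s0) = U0 at hc
  generalize hU : U0 ||| iterStep (V <<< (8 * 6561)) 5 U0 = U at hc
  obtain ⟨h1, h2⟩ := hc
  have h1 := Nat.eq_of_beq_eq_true h1
  have h2 := Nat.eq_of_beq_eq_true h2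
  have b0 : U0.testBit ((S 11 + pot V (s 11)) * 6561 + s 11) = true := by
    rw [← hU0]
    have := iterStep_mem hV hw n hS 11 0 (V &&& stateMask s0) (by omega) (by
      have h3 := pot_le_six hV (hw.lt 0)
      rw [Nat.testBit_and, hw.zero, zero_add, pot_mem hV (hw.lt 0), ← h0,
        stateMask_testBit _ _ (hw.lt 0) (by omega)]
      rfl)
    simpa using this
  have key : ∀ j, 11 + 5 * j ≤ n →
      U.testBit ((S (11 + 5 * j) + pot V (s (11 + 5 * j))) * 6561 + s (11 + 5 * j)) = true := by
    intro j
    induction j with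
    | zero =>
      intro _
      rw [← hU]
      exact testBit_or_left b0
    | succ j ih =>
      intro hj
      have := iterStep_mem hV hw n hS 5 _ _ (by omega) (ih (by omega))
      rw [← h1]
      exact testBit_or_right this
  have hj : n = 11 + 5 * ((n - 11) / 5) := by omega
  have h3 := key ((n - 11) / 5) (by omega)
  rw [← hj] at h3
  have h4 := congrArg (fun z => z.testBit ((S n + pot V (s n)) * 6561 + s n)) h2
  have h5 := pot_le_six hV (hw.lt n)
  have h6 := hS n le_rfl
  have h7 := stateMask_testBit (s n) (S n + pot V (s n)) (hw.lt n) (by omega)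
  rw [hsn] at h3 h4 h7
  simp only [Nat.testBit_and, h3, h7, Nat.zero_testBit] at h4
  exact absurd h4 (by decide)

theorem coreMask_false (t a : ℕ) (ht : t < 6561) (h1 : t ≠ 1328) (h2 : t ≠ 3931) (h3 : t ≠ 4087) :
    coreMask.testBit (a * 6561 + t) = false := by
  unfold coreMask
  rw [Nat.testBit_or, Nat.testBit_or, stateMask_testBit_false _ _ _ (by norm_num) ht h1,
    stateMask_testBit_false _ _ _ (by norm_num) ht h2,
    stateMask_testBit_false _ _ _ (by norm_num) ht h3]
  rfl

theorem runAvoid_false {V : ℕ} (hV : IsPot V) {s C S : ℕ → ℕ} (hw : IsWalk V s C S)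
    (hS : ∀ k, S k ≤ 2 * k / 3) (K : ℕ) (hK : ∀ k a, K.testBit (a * 6561 + s k) = false)
    (t : ℕ) : ∀ (k A b : ℕ), b + 2 * k / 3 = S k + pot V (s k) + 7 →
    A.testBit (b * 6561 + s k) = true → runAvoid (V <<< (8 * 6561)) K t k A = true → False := by
  induction t with
  | zero =>
    intro k A b _ hA hr
    have := Nat.eq_of_beq_eq_true hr
    subst this
    simp at hA
  | succ t ih =>
    intro k A b hb hA hr
    rw [runAvoid, strict_eq, strict_eq, Bool.and_eq_true] at hr
    obtain ⟨hr1, hr2⟩ := hr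
    have hr1 := Nat.eq_of_beq_eq_true hr1
    have h1 := hw.succ k
    have h2 := hS (k + 1)
    have h3 := pot_le_six hV (hw.lt (k + 1))
    have hE := hw.edge k A b hA (by omega)
    generalize hd : 2 * (k + 1) / 3 - 2 * k / 3 = d at hr1 hr2
    have hdd : 2 * (k + 1) / 3 = 2 * k / 3 + d := by omega
    have hlow : 2 + d ≤ b + C k := by
      by_contra hlt
      have h4 := congrArg (fun z => z.testBit ((b + C k) * 6561 + s (k + 1))) hr1
      have h5 : (b + C k) * 6561 + s (k + 1) < (2 + d) * 6561 := by
        have := hw.lt (k + 1)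
        omega
      simp only [Nat.testBit_mod_two_pow, h5, hE, Nat.zero_testBit] at h4
      exact absurd h4 (by decide)
    refine ih (k + 1) _ (b + C k - (2 + d)) (by omega) ?_ hr2
    apply remove_testBit _ _ _ _ (hK _ _)
    apply remove_testBit
    · rw [Nat.testBit_shiftRight]
      have h6 : (2 + d) * 6561 + ((b + C k - (2 + d)) * 6561 + s (k + 1))
          = (b + C k) * 6561 + s (k + 1) := by omega
      rwa [h6]
    · exact prune_false _ _ _ (hw.lt _) (by omega)

theorem no_walk_avoid {V : ℕ} (hV : IsPot V) (hc : checkAvoid V = true)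
    {s C S : ℕ → ℕ} (hw : IsWalk V s C S) (hS : ∀ k, S k ≤ 2 * k / 3)
    (hs : ∀ k, s k ≠ 1328 ∧ s k ≠ 3931 ∧ s k ≠ 4087) : False := by
  simp only [checkAvoid, strict_eq] at hc
  have hK : ∀ k a, coreMask.testBit (a * 6561 + s k) = false := fun k a =>
    coreMask_false _ _ (hw.lt k) (hs k).1 (hs k).2.1 (hs k).2.2
  refine runAvoid_false hV hw hS coreMask hK 41 0 _ (pot V (s 0) + 7) ?_ ?_ hc
  · rw [hw.zero]; omega
  · apply remove_testBit _ _ _ _ (hK _ _)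
    rw [Nat.testBit_shiftLeft]
    have e : (pot V (s 0) + 7) * 6561 + s 0 - 7 * 6561 = pot V (s 0) * 6561 + s 0 := by omega
    rw [e, pot_mem hV (hw.lt 0)]
    simp only [Bool.and_true, decide_eq_true_eq]
    omega

theorem IsWalk.mono {V : ℕ} (hV : IsPot V) {s C S : ℕ → ℕ} (hw : IsWalk V s C S) : Monotone S := by
  apply monotone_nat_of_le_succ
  intro k
  have h1 := hw.succ k
  have h2 := pot_edge hV (hw.lt k) (hw.lt (k + 1)) (hw.edge k)
  omega

theorem IsWalk.shift {V : ℕ} (hV : IsPot V) {s C S : ℕ → ℕ} (hw : IsWalk V s C S) (j : ℕ) :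
    IsWalk V (fun k => s (j + k)) (fun k => C (j + k)) (fun k => S (j + k) - S j) := by
  refine ⟨fun k => hw.lt _, fun k => hw.edge _, by simp, fun k => ?_⟩
  have h1 := hw.succ (j + k)
  have h2 := hw.mono hV (show j ≤ j + k by omega)
  have h3 := hw.mono hV (show j ≤ j + k + 1 by omega)
  have e : j + (k + 1) = j + k + 1 := by omega
  simp only [e]
  omega

theorem exists_walk {V : ℕ} (hV : IsPot V) {s C : ℕ → ℕ} (hlt : ∀ k, s k < 6561)
    (hE : ∀ k, Edge (s k) (C k) (s (k + 1))) : ∃ S, IsWalk V s C S := by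
  refine ⟨fun k => ∑ j ∈ Finset.range k, (pot V (s j) + C j - (2 + pot V (s (j + 1)))),
    hlt, hE, by simp, fun k => ?_⟩
  have h2 := pot_edge hV (hlt k) (hlt (k + 1)) (hE k)
  rw [Finset.sum_range_succ]
  omega

theorem slope_bound (n r k a b j : ℕ) (hn : 11 ≤ n) (ha : a ≤ 7)
    (h : (n : ℤ) * ((b : ℤ) + r) - a * ((j : ℤ) + k) ≤ n * b - a * j) : 11 * r ≤ 7 * k := by
  have h1 : (n : ℤ) * r ≤ a * k := by linarith
  have h2 : n * r ≤ a * k := by exact_mod_cast h1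
  exact (Nat.mul_le_mul_right r hn).trans (h2.trans (Nat.mul_le_mul_right k ha))

theorem no_closed_walk {V : ℕ} (h0 : checkV V = true) (h1 : checkStart V 1328 = true)
    (h2 : checkStart V 3931 = true) (h3 : checkStart V 4087 = true) (h4 : checkAvoid V = true)
    {s C : ℕ → ℕ} (hlt : ∀ k, s k < 6561) (hE : ∀ k, Edge (s k) (C k) (s (k + 1)))
    {n : ℕ} (h5 : n % 5 = 1) (hn : 11 ≤ n) (hs : ∀ k, s (k + n) = s k)
    (hC : ∀ k, C (k + n) = C k) (hsum : ∑ k ∈ Finset.range n, C k ≤ 2 * n + 7) : False := by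
  have hV := isPot_of_check V h0
  obtain ⟨S, hw⟩ := exists_walk hV hlt hE
  -- the total reduced cost
  have htot : ∀ k, ∑ j ∈ Finset.range k, C j + pot V (s 0) = S k + 2 * k + pot V (s k) := by
    intro k
    induction k with
    | zero => simp [hw.zero]
    | succ k ih =>
      rw [Finset.sum_range_succ]
      have := hw.succ k
      omega
  have hSn : S n ≤ 7 := by
    have h6 := htot n
    have h7 := hs 0
    rw [zero_add] at h7
    rw [h7] at h6
    omega
  have hper : ∀ k, S (k + n) = S k + S n := by
    intro k
    induction k with
    | zero => simp [hw.zero]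
    | succ k ih =>
      have a1 := hw.succ k
      have a2 := hw.succ (k + n)
      have e : k + n + 1 = k + 1 + n := by omega
      rw [hs, hC, e, hs] at a2
      omega
  have hmono := hw.mono hV
  by_cases hcore : ∃ j, s j = 1328 ∨ s j = 3931 ∨ s j = 4087
  · obtain ⟨j, hj⟩ := hcore
    have hw' := hw.shift hV j
    have hS' : ∀ k ≤ n, S (j + k) - S j ≤ 7 := by
      intro k hk
      have := hmono (show j + k ≤ j + n by omega)
      have := hper j
      omega
    rcases hj with hj | hj | hj
    · exact no_walk_core hV h1 hw' n h5 hn hS' hj (by simpa [hs] using hj)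
    · exact no_walk_core hV h2 hw' n h5 hn hS' hj (by simpa [hs] using hj)
    · exact no_walk_core hV h3 hw' n h5 hn hS' hj (by simpa [hs] using hj)
  · push Not at hcore
    -- cycle lemma
    let g : ℕ → ℤ := fun k => (n : ℤ) * S k - (S n : ℤ) * k
    have hg : ∀ k, g (k + n) = g k := by
      intro k
      simp only [g, hper]
      push_cast
      ring
    have hgm : ∀ k, g k = g (k % n) := by
      intro k
      induction k using Nat.strong_induction_on with
      | _ k ih =>
        by_cases hk : k < n
        · rw [Nat.mod_eq_of_lt hk]
        · have := ih (k - n) (by omega)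
          rw [← hg (k - n), Nat.sub_add_cancel (by omega), ← Nat.mod_eq_sub_mod (by omega)] at this
          exact this
    obtain ⟨j, -, hj⟩ := Finset.exists_max_image (Finset.range n) g ⟨0, by simp; omega⟩
    have hmax : ∀ k, g k ≤ g j := fun k => by
      rw [hgm k]
      exact hj _ (Finset.mem_range.2 (Nat.mod_lt _ (by omega)))
    refine no_walk_avoid hV h4 (hw.shift hV j) (fun k => ?_) (fun k => hcore _)
    have h6 := hmax (j + k)
    have h7 := hmono (show j ≤ j + k by omega)
    obtain ⟨r, hr⟩ := Nat.exists_eq_add_of_le h7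
    simp only [g, hr] at h6
    push_cast at h6
    have h9 := slope_bound n r k (S n) (S j) j hn hSn h6
    simp only [hr]
    omega

/-! ### From Roman dominating functions to closed walks -/

/-- The digits of the column `c` when the column to its left is `l`. -/
def dig (l c : ℕ → ℕ) (i : ℕ) : ℕ :=
  if c i = 2 then 2
  else if c i = 1 ∨ l i = 2 ∨ (0 < i ∧ c (i - 1) = 2) ∨ (i < 7 ∧ c (i + 1) = 2) then 1 else 0

theorem dig_lt (l c : ℕ → ℕ) (i : ℕ) : dig l c i < 3 := by
  unfold dig; split_ifs <;> omega

theorem dig_eq_two (l c : ℕ → ℕ) (i : ℕ) : dig l c i = 2 ↔ c i = 2 := by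
  unfold dig; split_ifs <;> simp_all

theorem gd_eq_two (u o x : ℕ) : gd u o x = 2 ↔ x = 2 := by
  unfold gd; split_ifs <;> simp_all

theorem gdig_eq_two (d x : ℕ → ℕ) (i : ℕ) : gdig d x i = 2 ↔ x i = 2 := by
  cases i <;> exact gd_eq_two _ _ _

theorem gdig_dig (l c e : ℕ → ℕ) (i : ℕ) : gdig (dig l c) e i =
    if e i = 2 then 2 else if e i = 1 ∨ c i = 2 ∨ (0 < i ∧ e (i - 1) = 2) then 1 else 0 := by
  cases i with
  | zero => simp [gdig, gd, dig_eq_two]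
  | succ i =>
    simp only [gdig, gd, dig_eq_two, gdig_eq_two]
    have : (e (i + 1) = 1 ∨ e i = 2 ∨ c (i + 1) = 2) ↔
      (e (i + 1) = 1 ∨ c (i + 1) = 2 ∨ (0 < i + 1 ∧ e (i + 1 - 1) = 2)) := by
      simp; tauto
    simp only [this]

theorem edig_dig (l c e : ℕ → ℕ) (i : ℕ) : edig (dig l c) e i = dig c e i := by
  unfold edig ud
  rw [gdig_dig]
  unfold dig
  split_ifs <;> grind

theorem sum_shift (F : ℕ → ℤ) (n : ℕ) (h : F n = F 0) :
    ∑ k ∈ Finset.range n, F (k + 1) = ∑ k ∈ Finset.range n, F k := by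
  have h1 := Finset.sum_range_succ F n
  have h2 := Finset.sum_range_succ' F n
  linarith

theorem enc_lt (d : ℕ → ℕ) (h : ∀ i, d i < 3) : enc d < 6561 := by
  have h0 := h 0
  have h1 := h 1
  have h2 := h 2
  have h3 := h 3
  have h4 := h 4
  have h5 := h 5
  have h6 := h 6
  have h7 := h 7
  unfold enc
  omega

theorem lower_seq (x : ℕ → ℕ → ℕ) (n : ℕ) (h5 : n % 5 = 1) (hn : 11 ≤ n)
    (hx : ∀ k i, x k i < 3) (hper : ∀ k, x (k + n) = x k)
    (hR : ∀ k, ∀ i < 8, x (k + 1) i = 0 → x k i = 2 ∨ x (k + 2) i = 2 ∨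
      (0 < i ∧ x (k + 1) (i - 1) = 2) ∨ (i < 7 ∧ x (k + 1) (i + 1) = 2)) :
    18 * n + 8 ≤ 5 * ∑ k ∈ Finset.range n, ∑ i ∈ Finset.range 8, x k i := by
  by_contra hlt
  have hz : ∀ k, ∀ i < 8, dig (x k) (x (k + 1)) i = 0 → x (k + 2) i = 2 := by
    intro k i hi h
    have h1 := hR k i hi
    have h2 := hx (k + 1) i
    unfold dig at h
    split_ifs at h with a b
    grind
  have hd : ∀ k, ∀ i < 8, dig (x k) (x (k + 1)) i < 3 := fun k i _ => dig_lt _ _ _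
  have hE : ∀ k, Edge (enc (dig (x k) (x (k + 1)))) (colCost (dig (x k) (x (k + 1))) (x (k + 2)))
      (enc (dig (x (k + 1)) (x (k + 1 + 1)))) := by
    intro k
    have h1 := edge_col _ (x (k + 2)) (hd k) (fun i _ => hx _ _) (hz k)
    rwa [show edig (dig (x k) (x (k + 1))) (x (k + 2)) = dig (x (k + 1)) (x (k + 1 + 1)) from
      funext fun i => edig_dig _ _ _ i] at h1
  have hc0 := checkV_potV
  have hc1 := checkStart_1328
  have hc2 := checkStart_3931
  have hc3 := checkStart_4087
  have hc4 := checkAvoid_potV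
  rw [strict_eq] at hc0 hc1 hc2 hc3 hc4
  have e1 : ∀ k, x (k + n + 1) = x (k + 1) := fun k => by
    rw [show k + n + 1 = k + 1 + n by omega, hper]
  have e2 : ∀ k, x (k + n + 2) = x (k + 2) := fun k => by
    rw [show k + n + 2 = k + 2 + n by omega, hper]
  refine no_closed_walk hc0 hc1 hc2 hc3 hc4 (fun k => enc_lt _ (dig_lt _ _)) hE h5 hn ?_ ?_ ?_
  · intro k
    simp only [hper, e1]
  · intro k
    simp only [hper, e1, e2]
  · have hsum : ∑ k ∈ Finset.range n, (colCost (dig (x k) (x (k + 1))) (x (k + 2)) : ℤ)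
        = 5 * ∑ k ∈ Finset.range n, ∑ i ∈ Finset.range 8, (x k i : ℤ) - 16 * n := by
      have h1 : ∀ k ∈ Finset.range n, (colCost (dig (x k) (x (k + 1))) (x (k + 2)) : ℤ)
          = 5 * ∑ i ∈ Finset.range 8, (x (k + 1 + 1) i : ℤ) - 16
            + (∑ i ∈ Finset.range 8, psi (dig (x (k + 1)) (x (k + 1 + 1)) i)
              - ∑ i ∈ Finset.range 8, psi (dig (x k) (x (k + 1)) i)) := by
        intro k _
        rw [colCost_eq _ _ (hd k) (fun i _ => hx _ _) (hz k)]
        simp only [edig_dig]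
        ring
      rw [Finset.sum_congr rfl h1, Finset.sum_add_distrib, Finset.sum_sub_distrib,
        Finset.sum_range_sub (fun k => ∑ i ∈ Finset.range 8, psi (dig (x k) (x (k + 1)) i)),
        ← Finset.mul_sum]
      have p0 := hper 0
      have p1 := hper 1
      rw [zero_add] at p0
      rw [add_comm] at p1
      rw [sum_shift (fun k => ∑ i ∈ Finset.range 8, (x (k + 1) i : ℤ)) n (by simp [p1]),
        sum_shift (fun k => ∑ i ∈ Finset.range 8, (x k i : ℤ)) n (by simp [p0]), p0, p1]
      simp
      ring
    zify
    rw [hsum]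
    zify at hlt
    linarith

theorem cycle_adj_iff (n : ℕ) (hn : 3 ≤ n) (u v : Fin n) :
    (SimpleGraph.cycleGraph n).Adj u v ↔ v.val = (u.val + 1) % n ∨ u.val = (v.val + 1) % n := by
  have key : ∀ a b : Fin n, (a - b).val = 1 ↔ a.val = (b.val + 1) % n := by
    intro a b
    have ha := a.isLt
    have hb := b.isLt
    have h1 : (b.val + 1) % n = if b.val + 1 < n then b.val + 1 else 0 := by
      split_ifs with h
      · exact Nat.mod_eq_of_lt h
      · rw [show b.val + 1 = n by omega, Nat.mod_self]
    have h2 : (a - b).val = if n - b.val + a.val < n then n - b.val + a.val else a.val - b.val := by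
      rw [Fin.sub_def]
      simp only
      split_ifs with h
      · exact Nat.mod_eq_of_lt h
      · rw [Nat.mod_eq_sub_mod (by omega), Nat.mod_eq_of_lt (by omega)]
        omega
    rw [h1, h2]
    split_ifs <;> omega
  rw [SimpleGraph.cycleGraph_adj', key, key]
  exact or_comm

theorem lower_bound (n : ℕ) (h5 : n % 5 = 1) (hn : 11 ≤ n) (f : Fin 8 × Fin n → Fin 3)
    (hf : IsRomanDominating ((SimpleGraph.pathGraph 8).boxProd (SimpleGraph.cycleGraph n)) f) :
    18 * n + 8 ≤ 5 * ∑ v, (f v : ℕ) := by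
  have hpos : 0 < n := by omega
  let x : ℕ → ℕ → ℕ := fun k i =>
    if h : i < 8 then (f (⟨i, h⟩, ⟨k % n, Nat.mod_lt _ hpos⟩) : ℕ) else 0
  have hxf : ∀ (k : ℕ) (a : Fin 8) (b : Fin n), b.val = k % n → f (a, b) = 2 → x k a = 2 := by
    intro k a b hb hv
    have : b = ⟨k % n, Nat.mod_lt _ hpos⟩ := Fin.ext hb
    simp only [x, a.isLt, dite_true]
    rw [← this, Fin.eta, hv]
    rfl
  have h1 := lower_seq x n h5 hn ?_ ?_ ?_
  · convert h1 using 2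
    rw [Fintype.sum_prod_type_right, Finset.sum_range]
    apply Finset.sum_congr rfl
    intro k _
    rw [Finset.sum_range]
    apply Finset.sum_congr rfl
    intro i _
    have hk : k.val % n = k.val := Nat.mod_eq_of_lt k.isLt
    simp only [x, i.isLt, dite_true, hk]
  · intro k i
    simp only [x]
    split_ifs
    · exact Fin.isLt _
    · omega
  · intro k
    simp only [x, Nat.add_mod_right]
  · intro k i hi h0
    have h0' : f (⟨i, hi⟩, ⟨(k + 1) % n, Nat.mod_lt _ hpos⟩) = 0 := by
      simp only [x, hi, dite_true] at h0
      exact Fin.ext h0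
    obtain ⟨⟨a, b⟩, hadj, hv⟩ := hf _ h0'
    rw [SimpleGraph.boxProd_adj] at hadj
    rcases hadj with ⟨ha, hb⟩ | ⟨hb, ha⟩
    · rw [SimpleGraph.pathGraph_adj] at ha
      simp only at ha hb
      have h2 := hxf (k + 1) a b (by rw [← hb]) hv
      have := a.isLt
      rcases ha with ha | ha
      · right; right; right
        rw [ha]
        exact ⟨by omega, h2⟩
      · right; right; left
        rw [← ha]
        exact ⟨by omega, by simpa using h2⟩
    · rw [cycle_adj_iff n (by omega)] at hb
      simp only at ha hb
      rcases hb with hb | hb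
      · right; left
        have h2 := hxf (k + 2) a b (by rw [hb, Nat.mod_add_mod]) hv
        rwa [← ha] at h2
      · left
        have h2 := hxf k a b (by
          have h3 : k + 1 ≡ b.val + 1 [MOD n] := hb
          have h4 := Nat.ModEq.add_right_cancel' 1 h3
          rw [Nat.ModEq, Nat.mod_eq_of_lt b.isLt] at h4
          exact h4.symm) hv
        rwa [← ha] at h2

/-! ### The upper bound -/

/-- The eleven different columns of an optimal function. -/
def colRow (a : Fin 11) : Fin 8 → Fin 3 :=
  ![![0, 0, 2, 0, 0, 0, 0, 2], ![1, 0, 0, 0, 2, 0, 0, 0], ![0, 2, 0, 0, 0, 0, 2, 0],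
    ![0, 0, 0, 2, 0, 0, 2, 0], ![2, 0, 0, 2, 0, 0, 0, 1], ![2, 0, 0, 0, 0, 2, 0, 0],
    ![0, 0, 2, 0, 0, 0, 0, 2], ![1, 0, 0, 0, 2, 0, 0, 0], ![0, 2, 0, 0, 0, 0, 2, 0],
    ![0, 0, 0, 2, 0, 0, 0, 1], ![2, 0, 0, 0, 0, 2, 0, 0]] a

/-- Which columns may follow each other. -/
def colNext (a b : Fin 11) : Prop :=
  b.val = a.val + 1 ∨ (a.val = 10 ∧ (b.val = 6 ∨ b.val = 0))

instance (a b : Fin 11) : Decidable (colNext a b) := by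
  unfold colNext; infer_instance

theorem colRow_dominating : ∀ b : Fin 11, ∀ i : Fin 8, colRow b i = 0 →
    (∃ j : Fin 8, (i.val + 1 = j.val ∨ j.val + 1 = i.val) ∧ colRow b j = 2) ∨
    (∀ a, colNext a b → colRow a i = 2) ∨ (∀ c, colNext b c → colRow c i = 2) := by
  decide +kernel

/-- The kind of column number `k`. -/
def colIdx (k : ℕ) : Fin 11 :=
  if h : k < 6 then ⟨k, by omega⟩ else ⟨6 + (k - 6) % 5, by omega⟩

theorem colIdx_val (k : ℕ) : (colIdx k).val = if k < 6 then k else 6 + (k - 6) % 5 := by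
  unfold colIdx
  split_ifs <;> rfl

theorem colIdx_next (m k : ℕ) (hk : k < 11 + 5 * m) :
    colNext (colIdx k) (colIdx ((k + 1) % (11 + 5 * m))) := by
  by_cases hl : k + 1 < 11 + 5 * m
  · rw [Nat.mod_eq_of_lt hl]
    unfold colNext
    rw [colIdx_val, colIdx_val]
    split_ifs <;> omega
  · rw [show k + 1 = 11 + 5 * m by omega, Nat.mod_self]
    unfold colNext
    rw [colIdx_val, colIdx_val]
    split_ifs <;> omega

theorem colRow_sum : (∑ i, (colRow 6 i : ℕ)) + ((∑ i, (colRow 7 i : ℕ))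
    + ((∑ i, (colRow 8 i : ℕ)) + ((∑ i, (colRow 9 i : ℕ)) + (∑ i, (colRow 10 i : ℕ))))) = 18 := by
  decide +kernel

theorem colIdx_sum (m : ℕ) :
    ∑ k ∈ Finset.range (6 + 5 * m), ∑ i, (colRow (colIdx k) i : ℕ) = 24 + 18 * m := by
  induction m with
  | zero => decide +kernel
  | succ m ih =>
    have e0 : colIdx (6 + 5 * m) = 6 := by
      apply Fin.ext
      rw [colIdx_val, if_neg (by omega)]
      change _ = 6
      omega
    have e1 : colIdx (6 + 5 * m + 1) = 7 := by
      apply Fin.ext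
      rw [colIdx_val, if_neg (by omega)]
      change _ = 7
      omega
    have e2 : colIdx (6 + 5 * m + 1 + 1) = 8 := by
      apply Fin.ext
      rw [colIdx_val, if_neg (by omega)]
      change _ = 8
      omega
    have e3 : colIdx (6 + 5 * m + 1 + 1 + 1) = 9 := by
      apply Fin.ext
      rw [colIdx_val, if_neg (by omega)]
      change _ = 9
      omega
    have e4 : colIdx (6 + 5 * m + 1 + 1 + 1 + 1) = 10 := by
      apply Fin.ext
      rw [colIdx_val, if_neg (by omega)]
      change _ = 10
      omega
    rw [show 6 + 5 * (m + 1) = 6 + 5 * m + 1 + 1 + 1 + 1 + 1 by ring]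
    rw [Finset.sum_range_succ, Finset.sum_range_succ, Finset.sum_range_succ,
      Finset.sum_range_succ, Finset.sum_range_succ, ih, e0, e1, e2, e3, e4]
    have s := colRow_sum
    linarith

theorem upper_bound (m n : ℕ) (hn : n = 11 + 5 * m) :
    ∃ f : Fin 8 × Fin n → Fin 3,
      IsRomanDominating ((SimpleGraph.pathGraph 8).boxProd (SimpleGraph.cycleGraph n)) f ∧
      ∑ v, (f v : ℕ) = 42 + 18 * m := by
  have hpos : 0 < n := by omega
  refine ⟨fun v => colRow (colIdx v.2.val) v.1, ?_, ?_⟩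
  · rintro ⟨i, k⟩ h0
    rcases colRow_dominating _ _ h0 with ⟨j, hj, hv⟩ | h | h
    · refine ⟨(j, k), ?_, hv⟩
      rw [SimpleGraph.boxProd_adj, SimpleGraph.pathGraph_adj]
      exact Or.inl ⟨hj, rfl⟩
    · have hk := k.isLt
      let l : Fin n := ⟨(k.val + (n - 1)) % n, Nat.mod_lt _ hpos⟩
      have hl : k.val = (l.val + 1) % n := by
        simp only [l]
        rw [Nat.mod_add_mod, show k.val + (n - 1) + 1 = k.val + n by omega, Nat.add_mod_right,
          Nat.mod_eq_of_lt hk]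
      refine ⟨(i, l), ?_, ?_⟩
      · rw [SimpleGraph.boxProd_adj]
        refine Or.inr ⟨?_, rfl⟩
        rw [cycle_adj_iff n (by omega)]
        exact Or.inr hl
      · apply h
        have h1 := colIdx_next m l.val (by have := l.isLt; omega)
        rw [← hn, ← hl] at h1
        exact h1
    · refine ⟨(i, ⟨(k.val + 1) % n, Nat.mod_lt _ hpos⟩), ?_, ?_⟩
      · rw [SimpleGraph.boxProd_adj]
        refine Or.inr ⟨?_, rfl⟩
        rw [cycle_adj_iff n (by omega)]
        exact Or.inl rfl
      · apply h
        have h1 := colIdx_next m k.val (by have := k.isLt; omega)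
        rw [← hn] at h1
        exact h1
  · rw [Fintype.sum_prod_type_right]
    simp only
    rw [← Finset.sum_range (fun k => ∑ i, (colRow (colIdx k) i : ℕ)),
      show n = 6 + 5 * (m + 1) by omega, colIdx_sum]
    ring

end RomanCyl

/-- for `n ≥ 3` with `n ≡ 1 (mod 5)` and `n ≠ 6`,
`γ_R(P₈ □ C_n) = ⌈18n/5⌉ + 2`. -/
theorem romanDominationNumber_P8_Cn_of_mod_five_eq_one (n : ℕ) (hn : 3 ≤ n)
    (h5 : n % 5 = 1) (h6 : n ≠ 6) :
    romanDominationNumber ((pathGraph 8).boxProd (cycleGraph n)) =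
      ⌈(18 * (n : ℚ)) / 5⌉₊ + 2 := by
  obtain ⟨m, hm⟩ : ∃ m, n = 11 + 5 * m := ⟨(n - 11) / 5, by omega⟩
  have hceil : ⌈(18 * (n : ℚ)) / 5⌉₊ = 40 + 18 * m := by
    rw [Nat.ceil_eq_iff (by omega), hm]
    rw [Nat.cast_sub (by omega)]
    push_cast
    constructor <;> linarith
  rw [hceil]
  obtain ⟨f, hf, hw⟩ := RomanCyl.upper_bound m n hm
  unfold romanDominationNumber
  apply le_antisymm
  · have h1 : (40 + 18 * m + 2) ∈ {k | ∃ f : Fin 8 × Fin n → Fin 3,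
        IsRomanDominating ((pathGraph 8).boxProd (cycleGraph n)) f ∧ ∑ v, (f v : ℕ) = k} :=
      ⟨f, hf, by omega⟩
    exact Nat.sInf_le h1
  · refine le_csInf ⟨42 + 18 * m, f, hf, hw⟩ ?_
    rintro k ⟨g, hg, rfl⟩
    have := RomanCyl.lower_bound n h5 (by omega) g hg
    omega
end

section
/- For every integer n ≥ 3 with n ≡ 0 (mod 5), the Roman domination number of the cylinder P₉ □ C_n equals 4n. -/
open SimpleGraph

/-- Potential of a column state in the four outer rows, packed in base 32. -/
def potential (a b c d : Fin 3) : ℕ :=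
  (47979863469439088626094290374313432639156964762729189622649073460379995625284791227980535773489660790759122964289990740032
    >>> (5 * (27 * a.val + 9 * b.val + 3 * c.val + d.val))) % 32

/-- State of a cell: 2 if it has value 2, 1 if it is satisfied by itself or by its left, upper or
lower neighbour, 0 if it still needs its right neighbour to have value 2. -/
def cellState (l u d x : Fin 3) : Fin 3 :=
  if x = 2 then 2 else if x = 1 ∨ l = 2 ∨ u = 2 ∨ d = 2 then 1 else 0

def outerCost (x : Fin 3) : ℕ := if x = 2 then 10 else if x = 1 then 5 else 0

def innerCost (x : Fin 3) : ℕ := if x = 2 then 8 else if x = 1 then 5 else 0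

def isTwo (x : Fin 3) : ℕ := if x = 2 then 1 else 0

def isOne (x : Fin 3) : ℕ := if x = 1 then 1 else 0

def colCost (a b c d e : Fin 3) : ℕ :=
  outerCost a + outerCost b + outerCost c + innerCost d + 2 * isTwo e

set_option maxRecDepth 100000 in
lemma potential_step :
    ∀ s0 x0 : Fin 3, (s0 = 0 → x0 = 2) → ∀ s1 x1 : Fin 3, (s1 = 0 → x1 = 2) →
    ∀ s2 x2 : Fin 3, (s2 = 0 → x2 = 2) → ∀ s3 x3 : Fin 3, (s3 = 0 → x3 = 2) → ∀ x4 : Fin 3,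
      potential (cellState s0 0 x1 x0) (cellState s1 x0 x2 x1)
        (cellState s2 x1 x3 x2) (cellState s3 x2 x4 x3) + 9
      ≤ potential s0 s1 s2 s3 + colCost x0 x1 x2 x3 x4 := by
  decide +kernel

lemma cellState_left : ∀ l l' u d x : Fin 3, (l = 2 ↔ l' = 2) →
    cellState l u d x = cellState l' u d x := by
  decide

lemma cellState_two : ∀ l u d x : Fin 3, cellState l u d x = 2 ↔ x = 2 := by
  decide

lemma cellState_zero : ∀ l u d x : Fin 3, cellState l u d x = 0 →
    x = 0 ∧ l ≠ 2 ∧ u ≠ 2 ∧ d ≠ 2 := by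
  decide

/-- Lower bound for one half of the cylinder: only domination of the four outermost rows is used. -/
lemma half_bound {J : Type*} [Fintype J] (σ : J ≃ J) (f0 f1 f2 f3 f4 : J → Fin 3)
    (h0 : ∀ j, f0 j = 0 → f0 (σ.symm j) = 2 ∨ f0 (σ j) = 2 ∨ f1 j = 2)
    (h1 : ∀ j, f1 j = 0 → f1 (σ.symm j) = 2 ∨ f1 (σ j) = 2 ∨ f0 j = 2 ∨ f2 j = 2)
    (h2 : ∀ j, f2 j = 0 → f2 (σ.symm j) = 2 ∨ f2 (σ j) = 2 ∨ f1 j = 2 ∨ f3 j = 2)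
    (h3 : ∀ j, f3 j = 0 → f3 (σ.symm j) = 2 ∨ f3 (σ j) = 2 ∨ f2 j = 2 ∨ f4 j = 2) :
    ∑ _j : J, 9 ≤ ∑ j, colCost (f0 j) (f1 j) (f2 j) (f3 j) (f4 j) := by
  let P : J → ℕ := fun j => potential
    (cellState (f0 (σ.symm j)) 0 (f1 j) (f0 j)) (cellState (f1 (σ.symm j)) (f0 j) (f2 j) (f1 j))
    (cellState (f2 (σ.symm j)) (f1 j) (f3 j) (f2 j)) (cellState (f3 (σ.symm j)) (f2 j) (f4 j) (f3 j))
  have key : ∀ j, P (σ j) + 9 ≤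
      P j + colCost (f0 (σ j)) (f1 (σ j)) (f2 (σ j)) (f3 (σ j)) (f4 (σ j)) := by
    intro j
    have := potential_step
      (cellState (f0 (σ.symm j)) 0 (f1 j) (f0 j)) (f0 (σ j)) (by
        intro h; obtain ⟨a, b, c, d⟩ := cellState_zero _ _ _ _ h; have := h0 j a; tauto)
      (cellState (f1 (σ.symm j)) (f0 j) (f2 j) (f1 j)) (f1 (σ j)) (by
        intro h; obtain ⟨a, b, c, d⟩ := cellState_zero _ _ _ _ h; have := h1 j a; tauto)
      (cellState (f2 (σ.symm j)) (f1 j) (f3 j) (f2 j)) (f2 (σ j)) (by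
        intro h; obtain ⟨a, b, c, d⟩ := cellState_zero _ _ _ _ h; have := h2 j a; tauto)
      (cellState (f3 (σ.symm j)) (f2 j) (f4 j) (f3 j)) (f3 (σ j)) (by
        intro h; obtain ⟨a, b, c, d⟩ := cellState_zero _ _ _ _ h; have := h3 j a; tauto)
      (f4 (σ j))
    rw [cellState_left _ _ _ _ _ (cellState_two (f0 (σ.symm j)) 0 (f1 j) (f0 j)),
      cellState_left _ _ _ _ _ (cellState_two (f1 (σ.symm j)) (f0 j) (f2 j) (f1 j)),
      cellState_left _ _ _ _ _ (cellState_two (f2 (σ.symm j)) (f1 j) (f3 j) (f2 j)),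
      cellState_left _ _ _ _ _ (cellState_two (f3 (σ.symm j)) (f2 j) (f4 j) (f3 j))] at this
    simpa only [P, Equiv.symm_apply_apply] using this
  have hs := Finset.sum_le_sum (fun j (_ : j ∈ Finset.univ) => key j)
  rw [Finset.sum_add_distrib, Finset.sum_add_distrib, Equiv.sum_comp σ P,
    Equiv.sum_comp σ (fun j => colCost (f0 j) (f1 j) (f2 j) (f3 j) (f4 j))] at hs
  omega

lemma mid_local : ∀ l r u d x : Fin 3, (x = 0 → l = 2 ∨ r = 2 ∨ u = 2 ∨ d = 2) →
    2 ≤ 2 * isTwo l + 2 * isTwo r + (2 * isTwo x + 2 * isOne x + 2 * isTwo u + 2 * isTwo d) := by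
  decide

lemma outerCost_eq : ∀ x : Fin 3, outerCost x = 5 * x.val := by decide

lemma innerCost_eq : ∀ x : Fin 3, innerCost x + 2 * isTwo x = 5 * x.val := by decide

lemma mid_cost : ∀ x : Fin 3, 10 * isTwo x + 2 * isOne x ≤ 5 * x.val := by decide

lemma cylinder_bound {J : Type*} [Fintype J] (σ : J ≃ J) (f : Fin 9 → J → Fin 3)
    (h : ∀ i j, f i j = 0 → f i (σ.symm j) = 2 ∨ f i (σ j) = 2 ∨
      ∃ k, (pathGraph 9).Adj i k ∧ f k j = 2) :
    4 * Fintype.card J ≤ ∑ j, ∑ i, (f i j : ℕ) := by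
  simp only [pathGraph_adj] at h
  have top := half_bound σ (f 0) (f 1) (f 2) (f 3) (f 4)
    (by intro j hj; have := h 0 j hj; simpa [Fin.exists_fin_succ] using this)
    (by intro j hj; have := h 1 j hj; simp [Fin.exists_fin_succ] at this; tauto)
    (by intro j hj; have := h 2 j hj; simp [Fin.exists_fin_succ] at this; tauto)
    (by intro j hj; have := h 3 j hj; simp [Fin.exists_fin_succ] at this; tauto)
  have bot := half_bound σ (f 8) (f 7) (f 6) (f 5) (f 4)
    (by intro j hj; have := h 8 j hj; simpa [Fin.exists_fin_succ] using this)
    (by intro j hj; have := h 7 j hj; simp [Fin.exists_fin_succ] at this; tauto)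
    (by intro j hj; have := h 6 j hj; simp [Fin.exists_fin_succ] at this; tauto)
    (by intro j hj; have := h 5 j hj; simp [Fin.exists_fin_succ] at this; tauto)
  have mid := Finset.sum_le_sum (fun j (_ : j ∈ Finset.univ) =>
    mid_local (f 4 (σ.symm j)) (f 4 (σ j)) (f 3 j) (f 5 j) (f 4 j)
    (by intro hj; have := h 4 j hj; simp [Fin.exists_fin_succ] at this; tauto))
  rw [Finset.sum_add_distrib, Finset.sum_add_distrib,
    Equiv.sum_comp σ.symm (fun j => 2 * isTwo (f 4 j)),
    Equiv.sum_comp σ (fun j => 2 * isTwo (f 4 j))] at mid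
  have tot : ∑ j, (colCost (f 0 j) (f 1 j) (f 2 j) (f 3 j) (f 4 j)
      + colCost (f 8 j) (f 7 j) (f 6 j) (f 5 j) (f 4 j) + (2 * isTwo (f 4 j) + 2 * isTwo (f 4 j)
      + (2 * isTwo (f 4 j) + 2 * isOne (f 4 j) + 2 * isTwo (f 3 j) + 2 * isTwo (f 5 j))))
      ≤ ∑ j, 5 * ∑ i, (f i j : ℕ) := by
    refine Finset.sum_le_sum fun j _ => ?_
    have e3 := innerCost_eq (f 3 j)
    have e5 := innerCost_eq (f 5 j)
    have e4 := mid_cost (f 4 j)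
    have hsum : ∑ i, (f i j : ℕ) = (f 0 j).val + (f 1 j).val + (f 2 j).val + (f 3 j).val
        + (f 4 j).val + (f 5 j).val + (f 6 j).val + (f 7 j).val + (f 8 j).val := by
      simp [Fin.sum_univ_succ]; ring_nf
    rw [hsum]
    simp only [colCost, outerCost_eq]
    omega
  rw [Finset.sum_add_distrib, Finset.sum_add_distrib, Finset.sum_add_distrib,
    Finset.sum_add_distrib] at tot
  have hm := Finset.mul_sum Finset.univ (fun j => ∑ i, (f i j : ℕ)) 5
  simp only [Finset.sum_const, Finset.card_univ, smul_eq_mul] at top bot mid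
  omega

/-- The optimal 5-periodic pattern. -/
def pattern (i : Fin 9) (r : ℕ) : Fin 3 :=
  if (2 * i.val) % 5 = r then 2 else if (i = 0 ∨ i = 8) ∧ r = 3 then 1 else 0

lemma pattern_sum : ∀ r : Fin 5, ∑ i, (pattern i r.val : ℕ) = 4 := by decide

lemma pattern_dom : ∀ (i : Fin 9) (r : Fin 5), pattern i r.val = 0 →
    pattern i ((r.val + 1) % 5) = 2 ∨ pattern i ((r.val + 4) % 5) = 2 ∨
    ∃ k : Fin 9, (i.val + 1 = k.val ∨ k.val + 1 = i.val) ∧ pattern k r.val = 2 := by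
  decide

/-- for `n ≥ 3` with `n ≡ 0 (mod 5)`, `γ_R(P₉ □ C_n) = 4n`. -/
theorem romanDominationNumber_P9_Cn_of_mod_five_eq_zero (n : ℕ) (hn : 3 ≤ n) (h5 : n % 5 = 0) :
    romanDominationNumber ((pathGraph 9).boxProd (cycleGraph n)) = 4 * n := by
  obtain ⟨m, rfl⟩ : ∃ m, n = m + 2 := ⟨n - 2, by omega⟩
  apply le_antisymm
  · apply Nat.sInf_le
    refine ⟨fun v => pattern v.1 (v.2.val % 5), ?_, ?_⟩
    · rintro ⟨i, j⟩ hij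
      have hv1 : (j + 1).val = (j.val + 1) % (m + 2) := by
        rw [Fin.val_add]; simp
      have hv2 : (j - 1).val = (j.val + (m + 1)) % (m + 2) := by
        rw [Fin.sub_def]; simp; congr 1; omega
      have hj := j.isLt
      have hd := pattern_dom i ⟨j.val % 5, Nat.mod_lt _ (by norm_num)⟩ hij
      simp only at hd
      rcases hd with hd | hd | ⟨k, hk, hd⟩
      · refine ⟨(i, j + 1), ?_, ?_⟩
        · rw [boxProd_adj]; right; simp [cycleGraph_adj]
        · simp only
          rw [← hd, hv1]
          congr 1
          rw [Nat.mod_mod_of_dvd _ (Nat.dvd_of_mod_eq_zero h5)]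
          omega
      · refine ⟨(i, j - 1), ?_, ?_⟩
        · rw [boxProd_adj]; right; simp [cycleGraph_adj]
        · simp only
          rw [← hd, hv2]
          congr 1
          rw [Nat.mod_mod_of_dvd _ (Nat.dvd_of_mod_eq_zero h5)]
          omega
      · refine ⟨(k, j), ?_, hd⟩
        rw [boxProd_adj]; left; simpa [pathGraph_adj] using hk
    · rw [Fintype.sum_prod_type_right]
      have : ∀ j : Fin (m + 2), ∑ i, (pattern i (j.val % 5) : ℕ) = 4 := fun j =>
        pattern_sum ⟨j.val % 5, Nat.mod_lt _ (by norm_num)⟩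
      simp only [this]
      simp [mul_comm]
  · apply le_csInf
    · exact ⟨_, fun _ => 2, fun v hv => absurd (show (2 : Fin 3) = 0 from hv) (by decide), rfl⟩
    · rintro k ⟨f, hf, rfl⟩
      have := cylinder_bound (Equiv.addRight (1 : Fin (m + 2))) (fun i j => f (i, j)) (by
        intro i j hij
        obtain ⟨⟨i', j'⟩, hadj, hw⟩ := hf (i, j) hij
        rw [boxProd_adj] at hadj
        rcases hadj with ⟨ha, hb⟩ | ⟨ha, hb⟩
        · right; right
          simp only at ha hb
          subst hb
          exact ⟨i', ha, hw⟩
        · simp only at ha hb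
          subst hb
          rw [cycleGraph_adj] at ha
          rcases ha with ha | ha
          · left
            have : j' = j + -1 := by rw [← sub_eq_add_neg, ← ha]; abel
            simpa [← this] using hw
          · right; left
            have : j' = j + 1 := by rw [← ha]; abel
            simpa [← this] using hw)
      rw [Fintype.sum_prod_type_right]
      simpa using this
end

section
/- For all integers m, n ≥ 4 with n ≡ 0 (mod 5), the Roman domination number of the cylinder P_m □ C_n equals 2(m+1)n/5. -/
open SimpleGraph

namespace RomanCyl

/-! ### The finite certificates

A cell state is `3` (value two), `2` (value one), `1` (value zero, already dominated), `0` (value zero,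
to be dominated by the next column).  The potentials are packed into one number. -/

/-- State of a cell with value `x`, state `a` on its left, value `u` above and `d` below. -/
def sym (a u x d : ℕ) : ℕ :=
  (105312289576189816854232921331047548925631745796408183762665685056 >>> (2 * (a + 4 * (u + 3 * (x + 3 * d))))) % 4

/-- Potential for four rows. -/
def pot4 (s : ℕ) : ℕ :=
  (47938483596327785537215753977367561559253019133600201725907659607017968202734848058961469662948109535530325657049706747694956378146184659003232462666220025678793974313509937096736440333153298776796555605897119831205019574528121953204483052245299324405987212900556630858854283548868570466895602352471163289872 >>> (4 * s)) % 16

/-- Potential for five rows. -/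
def pot5 (s : ℕ) : ℕ :=
  (102658648058297969831810281857297210583366038776116018111231321053109784900629265209332312755110959925108614277347500581133734419383037944093510835139719769247472280682399270618651199339185760925278110207160671089642775840844407373703630189673457514925058063204798464757472100982485002101917325474963206038323930384377862080416141554622429278890629553022909508944757492001751069144644882979098095007526308880658360348872983265762017420576731432152643784066622506114602736380525424588724070868551151545017539570689880068345986101079395173417019898644411775446231047271141796656854957025887888703484308142211499856354818365395871749997637472713690433077911106101697535918893268737229004118455358768627342622816423403457329402001438354036449092777102520015300531699824805564047750386270185013682128894243425762767656441072903090386428906049004248292595232917977325070424760826878976155235960477363369541796020914597205341292920862371223206733297392131946321223125976199344104386044295062544399768801913018571235974243473382264935557593026043981187935336357510859482811024165059973027852555418997478625189107267589098897027342364604972672915177235275554694371534859339747572722936787643358289716690387106902082868253022855936511808708127409161645299758202480984881034350708843957184873824657784254019526254471155025613884456955595240387185677961178107165215548968828526308918164817995026651236513667958408867978632874325561022873722739504916710701361427809506342060943478765519806319393435909346888798596098319107247805409563665546028663316735446446668366331007232161635700083039418737893344036269343303369434053762975974276532759873364604760761458478564030951350263731807317856707124226411627086925074539545158798392716014976908324165999579567472447652980954204105433046347092813667398085227761229408793520429421119984086101816181574744248759514826065578295293649703614617566954318285522636210037048466671863364573441351292577088887597707270165441821528442733630472569024497554868837346242092604427862141206909275881407487343949526961553572459382368562046763586475364066580495274350768273374567686770322888165004888351779105191557058646384409946810614493216915956410887661771881954799926543671922321048915382791712625270574281908674521058531628367581509885543859350998671315022921348817170032886028197110838514578895342040341158451845136546467564272577844683153497902894262773684203380977441546790253302519196186181707664128552535204713356539499358175030998776334846208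 >>> (8 * s)) % 256

/-- Potential for the four top rows of a higher cylinder. -/
def potO (s : ℕ) : ℕ :=
  (6590134571404597567204600627048321024548828995740634275152153652340656142248543187243896193066005406228788379386799494702531005509144424169906755068712314409965060622892227098107004948555173320598443233273268666639096587432107729032479590193950388497462244920457954454957916705287690863938912701369473067328846446274855678872329226508800219817413722759735705125979518427192244815330530502810076710957022129899898712947161794213226059791850366415231295833755911391790613612067568171126165738846175080996396445160873249546602660392608066912969508519525033799306179209690644045663109350619659846872284591970747499679232 >>> (8 * s)) % 256

/-- All pairs (value, state on the left) where the left cell has to be dominated. -/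
def rowR (p : ℕ → ℕ → Bool) : Bool :=
  p 0 1 && (p 0 2 && (p 0 3 && (p 1 1 && (p 1 2 && (p 1 3 && (p 2 0 && (p 2 1 && (p 2 2 && p 2 3))))))))

/-- All pairs (value, state on the left). -/
def rowU (p : ℕ → ℕ → Bool) : Bool :=
  p 0 0 && (p 1 0 && rowR p)

theorem rowR_spec {p : ℕ → ℕ → Bool} (h : rowR p = true) {x a : ℕ} (hx : x ≤ 2) (ha : a ≤ 3)
    (hxa : a = 0 → x = 2) : p x a = true := by
  simp only [rowR, Bool.and_eq_true] at h
  interval_cases x <;> interval_cases a <;> simp_all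

theorem rowU_spec {p : ℕ → ℕ → Bool} (h : rowU p = true) {x a : ℕ} (hx : x ≤ 2) (ha : a ≤ 3) :
    p x a = true := by
  simp only [rowU, rowR, Bool.and_eq_true] at h
  interval_cases x <;> interval_cases a <;> simp_all

theorem check4 : (rowR fun x0 a0 => rowR fun x1 a1 => rowR fun x2 a2 => rowR fun x3 a3 =>
    Nat.ble (2 + pot4 (sym a0 0 x0 x1 + 4 * (sym a1 x0 x1 x2 + 4 * (sym a2 x1 x2 x3 +
        4 * sym a3 x2 x3 0))))
      (x0 + x1 + x2 + x3 + pot4 (a0 + 4 * (a1 + 4 * (a2 + 4 * a3))))) = true := by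
  decide +kernel

theorem check5 : (rowR fun x0 a0 => rowR fun x1 a1 => rowR fun x2 a2 => rowR fun x3 a3 =>
    rowR fun x4 a4 =>
    Nat.ble (12 + pot5 (sym a0 0 x0 x1 + 4 * (sym a1 x0 x1 x2 + 4 * (sym a2 x1 x2 x3 +
        4 * (sym a3 x2 x3 x4 + 4 * sym a4 x3 x4 0)))))
      (5 * (x0 + x1 + x2 + x3 + x4) + pot5 (a0 + 4 * (a1 + 4 * (a2 + 4 * (a3 + 4 * a4)))))) = true := by
  decide +kernel

theorem checkO : (rowR fun x0 a0 => rowR fun x1 a1 => rowR fun x2 a2 => rowU fun x3 a3 =>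
    Nat.ble (26 + potO (sym a0 0 x0 x1 + 4 * (sym a1 x0 x1 x2 + 4 * (sym a2 x1 x2 x3 +
        4 * sym a3 x2 x3 0))))
      (40 * (x0 / 2) + 38 * (x1 / 2) + 26 * (x2 / 2) + 6 * (x3 / 2)
        + 20 * (x0 % 2) + 20 * (x1 % 2) + 15 * (x2 % 2) + 3 * (x3 % 2)
        + 2 * (x3 / 2 + x3 % 2 + x2 / 2 + a3 / 3 - 1) + 2 * (x3 / 2 * ((a3 + 3) / 4))
        + potO (a0 + 4 * (a1 + 4 * (a2 + 4 * a3))))) = true := by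
  decide +kernel

theorem sym_eq {a u x d : ℕ} (ha : a ≤ 3) (hu : u ≤ 2) (hx : x ≤ 2) (hd : d ≤ 2) :
    sym a u x d =
      if x = 2 then 3 else if x = 1 then 2 else if a = 3 ∨ u = 2 ∨ d = 2 then 1 else 0 := by
  have key : ∀ a : Fin 4, ∀ u x d : Fin 3, sym a u x d =
      if (x : ℕ) = 2 then 3 else if (x : ℕ) = 1 then 2 else
        if (a : ℕ) = 3 ∨ (u : ℕ) = 2 ∨ (d : ℕ) = 2 then 1 else 0 := by decide +kernel
  exact key ⟨a, by omega⟩ ⟨u, by omega⟩ ⟨x, by omega⟩ ⟨d, by omega⟩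

/-! ### Row form of Roman dominating functions on the cylinder -/

variable {k : ℕ}

/-- Rows `1, …, m` carry the function; rows `0` and `m + 1` are zero. -/
structure Good (m : ℕ) (F : ℕ → Fin (k + 2) → ℕ) : Prop where
  le : ∀ i j, F i j ≤ 2
  bot : ∀ j, F 0 j = 0
  top : ∀ j, F (m + 1) j = 0
  dom : ∀ i, i < m → ∀ j, F (i + 1) j = 0 →
    F i j = 2 ∨ F (i + 2) j = 2 ∨ F (i + 1) (j + 1) = 2 ∨ F (i + 1) (j - 1) = 2

theorem Good.reflect {m : ℕ} {F : ℕ → Fin (k + 2) → ℕ} (h : Good m F) :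
    Good m (fun i => F (m + 1 - i)) where
  le i j := h.le _ _
  bot j := by simpa using h.top j
  top j := by simpa using h.bot j
  dom i hi j h0 := by
    have e1 : m + 1 - (i + 1) = (m - 1 - i) + 1 := by omega
    have e2 : m + 1 - i = (m - 1 - i) + 2 := by omega
    have e3 : m + 1 - (i + 2) = m - 1 - i := by omega
    simp only [e1, e2, e3] at h0 ⊢
    have := h.dom (m - 1 - i) (by omega) j h0
    tauto

/-- State of the cell in row `i + 1`, where the row below is given explicitly. -/
def st (F : ℕ → Fin (k + 2) → ℕ) (i : ℕ) (d : ℕ) (j : Fin (k + 2)) : ℕ :=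
  sym (if F (i + 1) (j - 1) = 2 then 3 else 0) (F i j) (F (i + 1) j) d

section
variable {m : ℕ} {F : ℕ → Fin (k + 2) → ℕ}

theorem st_eq (h : Good m F) (i : ℕ) {d : ℕ} (hd : d ≤ 2) (j : Fin (k + 2)) :
    st F i d j = if F (i + 1) j = 2 then 3 else if F (i + 1) j = 1 then 2 else
      if F (i + 1) (j - 1) = 2 ∨ F i j = 2 ∨ d = 2 then 1 else 0 := by
  unfold st
  rw [sym_eq (by split_ifs <;> omega) (h.le _ _) (h.le _ _) hd]
  split_ifs <;> simp_all

theorem st_le (h : Good m F) (i : ℕ) {d : ℕ} (hd : d ≤ 2) (j : Fin (k + 2)) : st F i d j ≤ 3 := by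
  rw [st_eq h i hd]; split_ifs <;> omega

theorem st_zero (h : Good m F) {i : ℕ} (hi : i < m) (j : Fin (k + 2))
    (h0 : st F i (F (i + 2) j) j = 0) : F (i + 1) (j + 1) = 2 := by
  rw [st_eq h i (h.le _ _)] at h0
  have h1 := h.le (i + 1) j
  have h2 := h.dom i hi j
  split_ifs at h0 with a b c
  have := h2 (by omega)
  tauto

theorem st_succ (h : Good m F) (i : ℕ) {d d' : ℕ} (hd : d ≤ 2) (hd' : d' ≤ 2) (j : Fin (k + 2)) :
    sym (st F i d j) (F i (j + 1)) (F (i + 1) (j + 1)) d' = st F i d' (j + 1) := by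
  rw [sym_eq (st_le h i hd j) (h.le _ _) (h.le _ _) hd', st_eq h i hd', st_eq h i hd,
    add_sub_cancel_right]
  have h1 := h.le (i + 1) j
  split_ifs <;> simp_all

theorem sum_shift_s13 {M : Type*} [AddCommMonoid M] (g : Fin (k + 2) → M) :
    ∑ j, g (j + 1) = ∑ j, g j :=
  Equiv.sum_comp (Equiv.addRight (1 : Fin (k + 2))) g

theorem sum_shift' {M : Type*} [AddCommMonoid M] (g : Fin (k + 2) → M) :
    ∑ j, g (j - 1) = ∑ j, g j :=
  Equiv.sum_comp (Equiv.subRight (1 : Fin (k + 2))) g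

theorem lower4 (h : Good 4 F) :
    2 * (k + 2) ≤ ∑ j, F 1 j + ∑ j, F 2 j + ∑ j, F 3 j + ∑ j, F 4 j := by
  let P : Fin (k + 2) → ℕ := fun j => pot4 (st F 0 (F 2 j) j + 4 * (st F 1 (F 3 j) j +
    4 * (st F 2 (F 4 j) j + 4 * st F 3 (F 5 j) j)))
  have step : ∀ j, 2 + P (j + 1) ≤
      F 1 (j + 1) + F 2 (j + 1) + F 3 (j + 1) + F 4 (j + 1) + P j := by
    intro j
    have c := rowR_spec (rowR_spec (rowR_spec (rowR_spec check4
      (h.le 1 (j + 1)) (st_le h 0 (h.le 2 j) j) (st_zero h (by omega) j))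
      (h.le 2 (j + 1)) (st_le h 1 (h.le 3 j) j) (st_zero h (by omega) j))
      (h.le 3 (j + 1)) (st_le h 2 (h.le 4 j) j) (st_zero h (by omega) j))
      (h.le 4 (j + 1)) (st_le h 3 (h.le 5 j) j) (st_zero h (by omega) j)
    have c := Nat.le_of_ble_eq_true c
    have s0 := st_succ h 0 (h.le 2 j) (h.le 2 (j + 1)) j
    have s1 := st_succ h 1 (h.le 3 j) (h.le 3 (j + 1)) j
    have s2 := st_succ h 2 (h.le 4 j) (h.le 4 (j + 1)) j
    have s3 := st_succ h 3 (h.le 5 j) (h.le 5 (j + 1)) j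
    have t5 : F 5 (j + 1) = 0 := h.top _
    rw [h.bot] at s0
    simp only [Nat.reduceAdd] at s0 s1 s2 s3
    simp only [P]
    rw [← s0, ← s1, ← s2, ← s3, t5]
    exact c
  have S := Finset.sum_le_sum (fun j (_ : j ∈ Finset.univ) => step j)
  simp only [Finset.sum_add_distrib] at S
  rw [sum_shift_s13 P, sum_shift_s13 (F 1), sum_shift_s13 (F 2), sum_shift_s13 (F 3), sum_shift_s13 (F 4)] at S
  simp at S
  omega

theorem lower5 (h : Good 5 F) :
    12 * (k + 2) ≤ 5 * (∑ j, F 1 j + ∑ j, F 2 j + ∑ j, F 3 j + ∑ j, F 4 j + ∑ j, F 5 j) := by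
  let P : Fin (k + 2) → ℕ := fun j => pot5 (st F 0 (F 2 j) j + 4 * (st F 1 (F 3 j) j +
    4 * (st F 2 (F 4 j) j + 4 * (st F 3 (F 5 j) j + 4 * st F 4 (F 6 j) j))))
  have step : ∀ j, 12 + P (j + 1) ≤
      5 * (F 1 (j + 1) + F 2 (j + 1) + F 3 (j + 1) + F 4 (j + 1) + F 5 (j + 1)) + P j := by
    intro j
    have c := rowR_spec (rowR_spec (rowR_spec (rowR_spec (rowR_spec check5
      (h.le 1 (j + 1)) (st_le h 0 (h.le 2 j) j) (st_zero h (by omega) j))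
      (h.le 2 (j + 1)) (st_le h 1 (h.le 3 j) j) (st_zero h (by omega) j))
      (h.le 3 (j + 1)) (st_le h 2 (h.le 4 j) j) (st_zero h (by omega) j))
      (h.le 4 (j + 1)) (st_le h 3 (h.le 5 j) j) (st_zero h (by omega) j))
      (h.le 5 (j + 1)) (st_le h 4 (h.le 6 j) j) (st_zero h (by omega) j)
    have c := Nat.le_of_ble_eq_true c
    have s0 := st_succ h 0 (h.le 2 j) (h.le 2 (j + 1)) j
    have s1 := st_succ h 1 (h.le 3 j) (h.le 3 (j + 1)) j
    have s2 := st_succ h 2 (h.le 4 j) (h.le 4 (j + 1)) j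
    have s3 := st_succ h 3 (h.le 5 j) (h.le 5 (j + 1)) j
    have s4 := st_succ h 4 (h.le 6 j) (h.le 6 (j + 1)) j
    have t5 : F 6 (j + 1) = 0 := h.top _
    rw [h.bot] at s0
    simp only [Nat.reduceAdd] at s0 s1 s2 s3 s4
    simp only [P]
    rw [← s0, ← s1, ← s2, ← s3, ← s4, t5]
    exact c
  have S := Finset.sum_le_sum (fun j (_ : j ∈ Finset.univ) => step j)
  simp only [Finset.sum_add_distrib, ← Finset.mul_sum] at S
  rw [sum_shift_s13 P, sum_shift_s13 (F 1), sum_shift_s13 (F 2), sum_shift_s13 (F 3), sum_shift_s13 (F 4),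
    sum_shift_s13 (F 5)] at S
  simp at S
  omega

/-- Number of twos in row `i`. -/
def X (F : ℕ → Fin (k + 2) → ℕ) (i : ℕ) : ℕ := ∑ j, F i j / 2
/-- Number of ones in row `i`. -/
def V (F : ℕ → Fin (k + 2) → ℕ) (i : ℕ) : ℕ := ∑ j, F i j % 2

theorem row_cover (h : Good m F) {i : ℕ} (hi : i < m) :
    k + 2 ≤ 3 * X F (i + 1) + X F i + X F (i + 2) + V F (i + 1) := by
  have step : ∀ j, 1 ≤ F (i + 1) j / 2 + F (i + 1) (j + 1) / 2 + F (i + 1) (j - 1) / 2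
      + F i j / 2 + F (i + 2) j / 2 + F (i + 1) j % 2 := by
    intro j
    have := h.dom i hi j
    omega
  have S := Finset.sum_le_sum (fun j (_ : j ∈ Finset.univ) => step j)
  simp only [Finset.sum_add_distrib] at S
  rw [sum_shift_s13 (fun j => F (i + 1) j / 2), sum_shift' (fun j => F (i + 1) j / 2)] at S
  simp at S
  unfold X V
  omega

theorem top_loss (h : Good m F) (hm : 4 ≤ m) :
    28 * (k + 2) ≤ 40 * X F 1 + 38 * X F 2 + 28 * X F 3 + 12 * X F 4 + 2 * X F 5
      + 20 * V F 1 + 20 * V F 2 + 15 * V F 3 + 5 * V F 4 := by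
  let P : Fin (k + 2) → ℕ := fun j => potO (st F 0 (F 2 j) j + 4 * (st F 1 (F 3 j) j +
    4 * (st F 2 (F 4 j) j + 4 * st F 3 0 j)))
  let A : Fin (k + 2) → ℕ := fun j =>
    F 4 j / 2 + F 4 j % 2 + F 3 j / 2 + F 4 (j - 1) / 2 - 1
  let B : Fin (k + 2) → ℕ := fun j => F 4 (j + 1) / 2 * ((st F 3 0 j + 3) / 4)
  have step : ∀ j, 26 + P (j + 1) ≤
      40 * (F 1 (j + 1) / 2) + 38 * (F 2 (j + 1) / 2) + 26 * (F 3 (j + 1) / 2)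
      + 6 * (F 4 (j + 1) / 2) + 20 * (F 1 (j + 1) % 2) + 20 * (F 2 (j + 1) % 2)
      + 15 * (F 3 (j + 1) % 2) + 3 * (F 4 (j + 1) % 2) + 2 * A (j + 1) + 2 * B j + P j := by
    intro j
    have c := rowU_spec (rowR_spec (rowR_spec (rowR_spec checkO
      (h.le 1 (j + 1)) (st_le h 0 (h.le 2 j) j) (st_zero h (by omega) j))
      (h.le 2 (j + 1)) (st_le h 1 (h.le 3 j) j) (st_zero h (by omega) j))
      (h.le 3 (j + 1)) (st_le h 2 (h.le 4 j) j) (st_zero h (by omega) j))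
      (h.le 4 (j + 1)) (st_le h 3 (Nat.zero_le 2) j)
    have c := Nat.le_of_ble_eq_true c
    have s0 := st_succ h 0 (h.le 2 j) (h.le 2 (j + 1)) j
    have s1 := st_succ h 1 (h.le 3 j) (h.le 3 (j + 1)) j
    have s2 := st_succ h 2 (h.le 4 j) (h.le 4 (j + 1)) j
    have s3 := st_succ h 3 (Nat.zero_le 2) (Nat.zero_le 2) j
    have s4 : F 4 j / 2 = st F 3 0 j / 3 := by
      rw [st_eq h 3 (Nat.zero_le 2) j]
      have := h.le 4 j
      simp only [Nat.reduceAdd]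
      split_ifs <;> omega
    rw [h.bot] at s0
    simp only [Nat.reduceAdd] at s0 s1 s2 s3
    simp only [P, A, B, add_sub_cancel_right]
    rw [← s0, ← s1, ← s2, ← s3, s4]
    exact c
  have step2 : ∀ j, 1 + (A j + B j) ≤ F 4 j / 2 + F 4 (j + 1) / 2 + F 4 (j - 1) / 2
      + F 3 j / 2 + F 5 j / 2 + F 4 j % 2 := by
    intro j
    have d := h.dom 3 (by omega) j
    have l1 := h.le 4 j
    have l2 := h.le 4 (j + 1)
    have l3 := h.le 4 (j - 1)
    have l4 := h.le 3 j
    simp only [A, B]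
    rw [st_eq h 3 (Nat.zero_le 2) j]
    simp only [Nat.reduceAdd, OfNat.zero_ne_ofNat, or_false] at d ⊢
    split_ifs <;> omega
  have S := Finset.sum_le_sum (fun j (_ : j ∈ Finset.univ) => step j)
  have S2 := Finset.sum_le_sum (fun j (_ : j ∈ Finset.univ) => step2 j)
  simp only [Finset.sum_add_distrib, ← Finset.mul_sum] at S S2
  rw [sum_shift_s13 P, sum_shift_s13 A, sum_shift_s13 (fun j => F 1 j / 2), sum_shift_s13 (fun j => F 2 j / 2),
    sum_shift_s13 (fun j => F 3 j / 2), sum_shift_s13 (fun j => F 4 j / 2), sum_shift_s13 (fun j => F 1 j % 2),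
    sum_shift_s13 (fun j => F 2 j % 2), sum_shift_s13 (fun j => F 3 j % 2),
    sum_shift_s13 (fun j => F 4 j % 2)] at S
  rw [sum_shift_s13 (fun j => F 4 j / 2), sum_shift' (fun j => F 4 j / 2)] at S2
  simp at S S2
  unfold X V
  omega

/-- Four times the weight of a row in the loss of the top boundary. -/
def wt : ℕ → ℤ
  | 0 => 4
  | 1 => 4
  | 2 => 3
  | 3 => 1
  | _ + 4 => 0

theorem wt_nonneg (i : ℕ) : 0 ≤ wt i := by
  rcases i with _ | _ | _ | _ | i <;> simp [wt]

theorem wt_add (i i' : ℕ) (h : 5 ≤ i + i') : wt i + wt i' ≤ 4 := by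
  rcases i with _ | _ | _ | _ | i <;> rcases i' with _ | _ | _ | _ | i' <;> simp [wt] <;> omega

/-- Loss of row `i + 1`. -/
def loss (F : ℕ → Fin (k + 2) → ℕ) (i : ℕ) : ℤ :=
  6 * X F (i + 1) + 2 * X F i + 2 * X F (i + 2) + 5 * V F (i + 1) - 2 * (k + 2)

theorem loss_nonneg (h : Good m F) {i : ℕ} (hi : i < m) : 0 ≤ loss F i := by
  have := row_cover h hi
  unfold loss
  omega

theorem top_sum (h : Good m F) (hm : 4 ≤ m) :
    4 * (k + 2 : ℤ) ≤ 8 * X F 1 + ∑ i ∈ Finset.range m, wt i * loss F i := by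
  obtain ⟨q, rfl⟩ := Nat.exists_eq_add_of_le' hm
  have hz : ∑ i ∈ Finset.range q, wt (i + 1 + 1 + 1 + 1) * loss F (i + 1 + 1 + 1 + 1) = 0 :=
    Finset.sum_eq_zero fun i _ => by simp [wt]
  rw [Finset.sum_range_succ', Finset.sum_range_succ', Finset.sum_range_succ',
    Finset.sum_range_succ', hz]
  have := top_loss h (by omega)
  have h0 : X F 0 = 0 := by simp [X, h.bot]
  simp only [wt, loss, Nat.reduceAdd, h0]
  push_cast
  omega

theorem lower6 (h : Good m F) (hm : 6 ≤ m) :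
    2 * (m + 1) * (k + 2) ≤ 5 * ∑ i ∈ Finset.range m, ∑ j, F (i + 1) j := by
  have t1 := top_sum h (by omega)
  have t2 := top_sum h.reflect (by omega)
  have e : ∑ i ∈ Finset.range m, wt i * loss (fun i => F (m + 1 - i)) i
      = ∑ i ∈ Finset.range m, wt (m - 1 - i) * loss F i := by
    rw [← Finset.sum_range_reflect]
    refine Finset.sum_congr rfl fun i hi => ?_
    have hi := Finset.mem_range.1 hi
    have e1 : m + 1 - (m - 1 - i + 1) = i + 1 := by omega
    have e2 : m + 1 - (m - 1 - i) = i + 2 := by omega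
    have e3 : m + 1 - (m - 1 - i + 2) = i := by omega
    congr 1
    simp only [loss, X, V, e1, e2, e3]
    ring
  have eX : X (fun i => F (m + 1 - i)) 1 = X F m := by simp [X]
  rw [e, eX] at t2
  have t3 : ∑ i ∈ Finset.range m, wt i * loss F i + ∑ i ∈ Finset.range m, wt (m - 1 - i) * loss F i
      ≤ ∑ i ∈ Finset.range m, 4 * loss F i := by
    rw [← Finset.sum_add_distrib]
    refine Finset.sum_le_sum fun i hi => ?_
    have hi := Finset.mem_range.1 hi
    rw [← add_mul]
    exact mul_le_mul_of_nonneg_right (wt_add _ _ (by omega)) (loss_nonneg h hi)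
  rw [← Finset.mul_sum] at t3
  have x0 : X F 0 = 0 := by simp [X, h.bot]
  have xm : X F (m + 1) = 0 := by simp [X, h.top]
  have r1 : ∑ i ∈ Finset.range m, (X F i : ℤ) = ∑ i ∈ Finset.range m, (X F (i + 1) : ℤ) - X F m := by
    have a := Finset.sum_range_succ (fun i => (X F i : ℤ)) m
    have b := Finset.sum_range_succ' (fun i => (X F i : ℤ)) m
    simp only [x0] at b
    push_cast at b
    linarith
  have r2 : ∑ i ∈ Finset.range m, (X F (i + 2) : ℤ)
      = ∑ i ∈ Finset.range m, (X F (i + 1) : ℤ) - X F 1 := by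
    have a := Finset.sum_range_succ (fun i => (X F (i + 1) : ℤ)) m
    have b := Finset.sum_range_succ' (fun i => (X F (i + 1) : ℤ)) m
    simp only [xm] at a
    push_cast at a
    simp only [zero_add, add_assoc, Nat.reduceAdd] at b
    linarith
  have L : ∑ i ∈ Finset.range m, loss F i = 10 * ∑ i ∈ Finset.range m, (X F (i + 1) : ℤ)
      - 2 * X F m - 2 * X F 1 + 5 * ∑ i ∈ Finset.range m, (V F (i + 1) : ℤ) - m * (2 * (k + 2)) := by
    simp only [loss, Finset.sum_sub_distrib, Finset.sum_add_distrib, ← Finset.mul_sum, r1, r2]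
    simp
    ring
  have W : ∑ i ∈ Finset.range m, ∑ j, F (i + 1) j
      = 2 * ∑ i ∈ Finset.range m, X F (i + 1) + ∑ i ∈ Finset.range m, V F (i + 1) := by
    rw [Finset.mul_sum, ← Finset.sum_add_distrib]
    refine Finset.sum_congr rfl fun i _ => ?_
    simp only [X, V]
    rw [Finset.mul_sum, ← Finset.sum_add_distrib]
    exact Finset.sum_congr rfl fun j _ => by omega
  rw [W]
  zify
  rw [L] at t3
  linarith

theorem lower (h : Good m F) (hm : 4 ≤ m) :
    2 * (m + 1) * (k + 2) ≤ 5 * ∑ i ∈ Finset.range m, ∑ j, F (i + 1) j := by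
  rcases Nat.lt_or_ge m 6 with h6 | h6
  · interval_cases m
    · have := lower4 h
      simp only [Finset.sum_range_succ, Finset.sum_range_zero, Nat.reduceAdd]
      omega
    · have := lower5 h
      simp only [Finset.sum_range_succ, Finset.sum_range_zero, Nat.reduceAdd]
      omega
  · exact lower6 h h6

end

/-! ### Translation to the graph -/

theorem cyl_lower {m : ℕ} (hm : 4 ≤ m) (f : Fin m × Fin (k + 2) → Fin 3)
    (hf : IsRomanDominating ((pathGraph m).boxProd (cycleGraph (k + 2))) f) :
    2 * (m + 1) * (k + 2) ≤ 5 * ∑ v, (f v : ℕ) := by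
  let F : ℕ → Fin (k + 2) → ℕ := fun i j =>
    if h : 1 ≤ i ∧ i ≤ m then (f (⟨i - 1, by omega⟩, j) : ℕ) else 0
  have hF : ∀ (i : Fin m) j, F (i + 1) j = f (i, j) := by
    intro i j
    have := i.2
    simp only [F]
    rw [dif_pos (by omega)]
    simp
  have hG : Good m F := by
    refine ⟨?_, ?_, ?_, ?_⟩
    · intro i j
      simp only [F]
      split_ifs <;> omega
    · intro j; simp [F]
    · intro j; simp [F]
    · intro i hi j h0
      have h1 := hF ⟨i, hi⟩ j
      simp only at h1
      rw [h1] at h0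
      obtain ⟨⟨i', j'⟩, hadj, h2⟩ := hf (⟨i, hi⟩, j) (by ext; simpa using h0)
      have h3 := hF i' j'
      rw [h2] at h3
      rw [boxProd_adj] at hadj
      simp only [pathGraph_adj, cycleGraph_adj] at hadj
      rcases hadj with ⟨h4 | h4, rfl⟩ | ⟨h4 | h4, rfl⟩
      · right; left
        rw [← h4] at h3
        simpa using h3
      · left
        rw [h4] at h3
        simpa using h3
      · right; right; right
        have : j' = j - 1 := by rw [← h4]; abel
        rw [← this]
        simpa using h3
      · right; right; left
        have : j' = j + 1 := by rw [← h4]; abel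
        rw [← this]
        simpa using h3
  have := lower hG hm
  rw [Fintype.sum_prod_type, ← Fin.sum_univ_eq_sum_range (fun i => ∑ j, F (i + 1) j)] at *
  simpa only [hF] using this

theorem sum_mod5 (g : ℕ → ℕ) (c q : ℕ) :
    ∑ j ∈ Finset.range (5 * q), g ((j + c) % 5) = q * (g 0 + g 1 + g 2 + g 3 + g 4) := by
  induction q with
  | zero => simp
  | succ q ih =>
    rw [show 5 * (q + 1) = 5 * q + 1 + 1 + 1 + 1 + 1 by ring]
    simp only [Finset.sum_range_succ, ih]
    have : c % 5 < 5 := Nat.mod_lt _ (by norm_num)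
    have e0 : (5 * q + c) % 5 = c % 5 := by omega
    have e1 : (5 * q + 1 + c) % 5 = (c % 5 + 1) % 5 := by omega
    have e2 : (5 * q + 1 + 1 + c) % 5 = (c % 5 + 2) % 5 := by omega
    have e3 : (5 * q + 1 + 1 + 1 + c) % 5 = (c % 5 + 3) % 5 := by omega
    have e4 : (5 * q + 1 + 1 + 1 + 1 + c) % 5 = (c % 5 + 4) % 5 := by omega
    rw [e0, e1, e2, e3, e4]
    generalize c % 5 = r at *
    interval_cases r <;> simp <;> ring

/-- The optimal function: value at row `i` and residue `r`. -/
def opt (m i r : ℕ) : Fin 3 :=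
  if r = 0 then 2 else if (i = 0 ∧ r = 2) ∨ (i + 1 = m ∧ r = 3) then 1 else 0

theorem cyl_upper {m q : ℕ} (hm : 4 ≤ m) (hq : k + 2 = 5 * q) :
    ∃ f : Fin m × Fin (k + 2) → Fin 3,
      IsRomanDominating ((pathGraph m).boxProd (cycleGraph (k + 2))) f ∧
      ∑ v, (f v : ℕ) = 2 * (m + 1) * q := by
  refine ⟨fun v => opt m v.1 ((v.2 + 2 * v.1) % 5), ?_, ?_⟩
  · rintro ⟨⟨i, hi⟩, j⟩ h0
    have key : ∀ a : Fin (k + 2), ((a + 1 : Fin (k + 2)) : ℕ) % 5 = (a + 1 : ℕ) % 5 := by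
      intro a
      rw [Fin.val_add, Nat.mod_mod_of_dvd _ ⟨q, hq⟩]
      simp
    have h2 : ∀ i' r, r = 0 → opt m i' r = 2 := fun i' r h => by simp [opt, h]
    have hlt : ((j : ℕ) + 2 * i) % 5 < 5 := Nat.mod_lt _ (by norm_num)
    simp only [opt] at h0
    have hr0 : ((j : ℕ) + 2 * i) % 5 ≠ 0 := fun h => by simp [h] at h0
    rw [if_neg hr0] at h0
    have hr : ¬ ((i = 0 ∧ ((j : ℕ) + 2 * i) % 5 = 2) ∨ (i + 1 = m ∧ ((j : ℕ) + 2 * i) % 5 = 3)) := by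
      intro h
      rw [if_pos h] at h0
      simp at h0
    by_cases c1 : ((j : ℕ) + 2 * i) % 5 = 1
    · refine ⟨(⟨i, hi⟩, j - 1), ?_, h2 _ _ ?_⟩
      · rw [boxProd_adj]; right
        simp [cycleGraph_adj]
      · have := key (j - 1)
        rw [sub_add_cancel] at this
        simp only
        omega
    by_cases c4 : ((j : ℕ) + 2 * i) % 5 = 4
    · refine ⟨(⟨i, hi⟩, j + 1), ?_, h2 _ _ ?_⟩
      · rw [boxProd_adj]; right
        simp [cycleGraph_adj]
      · have := key j
        simp only
        omega
    by_cases c2 : ((j : ℕ) + 2 * i) % 5 = 2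
    · refine ⟨(⟨i - 1, by omega⟩, j), ?_, h2 _ _ ?_⟩
      · rw [boxProd_adj]; left
        refine ⟨?_, rfl⟩
        simp only [pathGraph_adj]
        omega
      · simp only
        omega
    · refine ⟨(⟨i + 1, by omega⟩, j), ?_, h2 _ _ ?_⟩
      · rw [boxProd_adj]; left
        refine ⟨?_, rfl⟩
        simp [pathGraph_adj]
      · simp only
        omega
  · rw [Fintype.sum_prod_type]
    have row : ∀ i : Fin m, ∑ j : Fin (k + 2), (opt m i (((j : ℕ) + 2 * i) % 5) : ℕ)
        = 2 * q + (if (i : ℕ) = 0 then q else 0) + (if (i : ℕ) + 1 = m then q else 0) := by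
      intro i
      rw [Fin.sum_univ_eq_sum_range (fun j => (opt m i ((j + 2 * i) % 5) : ℕ)), hq,
        sum_mod5 (fun r => (opt m i r : ℕ))]
      simp only [opt]
      split_ifs <;> simp_all <;> omega
    simp only [row]
    rw [Fin.sum_univ_eq_sum_range
      (fun i => 2 * q + (if i = 0 then q else 0) + (if i + 1 = m then q else 0))]
    obtain ⟨p, rfl⟩ := Nat.exists_eq_add_of_le' (show 1 ≤ m by omega)
    simp [Finset.sum_add_distrib]
    ring

end RomanCyl

/-- for `m, n ≥ 4` with `n ≡ 0 (mod 5)`,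
`γ_R(P_m □ C_n) = 2(m+1)n/5` (the division is exact since `5 ∣ n`). -/
theorem romanDominationNumber_cylinder_of_mod_five_eq_zero' (m n : ℕ)
    (hm : 4 ≤ m) (hn : 4 ≤ n) (h5 : n % 5 = 0) :
    romanDominationNumber ((pathGraph m).boxProd (cycleGraph n)) = 2 * (m + 1) * n / 5 := by
  obtain ⟨k, rfl⟩ := Nat.exists_eq_add_of_le' (show 2 ≤ n by omega)
  obtain ⟨q, hq⟩ := Nat.dvd_of_mod_eq_zero h5
  have e : 2 * (m + 1) * (k + 2) / 5 = 2 * (m + 1) * q := by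
    rw [hq, show 2 * (m + 1) * (5 * q) = 5 * (2 * (m + 1) * q) by ring]
    simp
  rw [e]
  have up := RomanCyl.cyl_upper hm hq
  unfold romanDominationNumber
  apply le_antisymm
  · exact Nat.sInf_le up
  · refine le_csInf ⟨_, up⟩ ?_
    rintro w ⟨f, hf, rfl⟩
    have := RomanCyl.cyl_lower hm f hf
    have e2 : 2 * (m + 1) * (k + 2) = 5 * (2 * (m + 1) * q) := by rw [hq]; ring
    rw [e2] at this
    omega
end
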